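/- arXiv:1208.5177 — 13 statements merged into one kernel-verified Lean document; each statement's English description precedes it below -/
import Mathlib

section
/- In ℝ[x,y], the Jacobian determinant of the van den Essen Pinchuk map satisfies the polynomial identity (∂P/∂x)·(∂Q/∂y) − (∂P/∂y)·(∂Q/∂x) = t² + (t + f·(13 + 15h))² + f². -/
noncomputable section

abbrev R2 : Type := MvPolynomial (Fin 2) ℝ

def x : R2 := MvPolynomial.X 0
def y : R2 := MvPolynomial.X 1
def t : R2 := x * y - 1
def h : R2 := t * (x * t + 1)
def f : R2 := (x * t + 1) ^ 2 * (t ^ 2 + y)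
def P : R2 := f + h
def q : R2 := -t ^ 2 - 6 * t * h * (h + 1)
def u : R2 :=
  170 * f * h + 91 * h ^ 2 + 195 * f * h ^ 2 + 69 * h ^ 3 + 75 * f * h ^ 3 + MvPolynomial.C (75 / 4 : ℝ) * h ^ 4
def Q : R2 := q - u

open MvPolynomial in
theorem pderiv_zero_t : pderiv 0 t = y := by
  simp [t, x, y, pderiv_X]

open MvPolynomial in
theorem pderiv_one_t : pderiv 1 t = x := by
  simp [t, x, y, pderiv_X]

open MvPolynomial in
theorem pderiv_h (i : Fin 2) :
    pderiv i h = (2 * x * t + 1) * pderiv i t + t ^ 2 * pderiv i x := by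
  simp only [h, map_add, Derivation.leibniz, smul_eq_mul, Derivation.map_one_eq_zero]
  ring

open MvPolynomial in
theorem pderiv_f (i : Fin 2) :
    pderiv i f = 2 * (x * t + 1) * (t ^ 2 + y) * (x * pderiv i t + t * pderiv i x) +
      (x * t + 1) ^ 2 * (2 * t * pderiv i t + pderiv i y) := by
  simp only [f, map_add, Derivation.leibniz, Derivation.leibniz_pow, smul_eq_mul, nsmul_eq_mul,
    Derivation.map_one_eq_zero]
  push_cast
  ring

theorem f_mul_h_sub_t : f * (h - t) = h ^ 2 * (h + 1) := by
  simp only [f, h, t]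
  ring

/-- The Jacobian determinant of a pair of polynomials in two variables. -/
def jacobian (a b : R2) : R2 :=
  MvPolynomial.pderiv 0 a * MvPolynomial.pderiv 1 b -
    MvPolynomial.pderiv 1 a * MvPolynomial.pderiv 0 b

theorem jacobian_t_h : jacobian t h = t - h := by
  simp only [jacobian, pderiv_h, pderiv_zero_t, pderiv_one_t]
  simp [x, y, h, t, MvPolynomial.pderiv_X]
  ring

theorem jacobian_t_f : jacobian t f = f - (3 * h ^ 2 + 2 * h) := by
  simp only [jacobian, pderiv_f, pderiv_zero_t, pderiv_one_t]
  simp [x, y, h, t, f, MvPolynomial.pderiv_X]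
  ring

theorem jacobian_h_f : jacobian h f = f := by
  simp only [jacobian, pderiv_h, pderiv_f, pderiv_zero_t, pderiv_one_t]
  simp [x, y, t, f, MvPolynomial.pderiv_X]
  ring

open MvPolynomial in
theorem pderiv_P (i : Fin 2) : pderiv i P = pderiv i f + pderiv i h := by
  simp only [P, map_add]

open MvPolynomial in
theorem pderiv_Q (i : Fin 2) :
    pderiv i Q = (-2 * t - 6 * h * (h + 1)) * pderiv i t -
      (170 * h + 195 * h ^ 2 + 75 * h ^ 3) * pderiv i f -
      (6 * t * (2 * h + 1) + 170 * f + 182 * h + 390 * f * h + 207 * h ^ 2 +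
        225 * f * h ^ 2 + 75 * h ^ 3) * pderiv i h := by
  have hnum (n : ℕ) [n.AtLeastTwo] : pderiv i (OfNat.ofNat n : R2) = 0 :=
    (pderiv i).map_natCast n
  have hC : (4 : R2) * C (75 / 4 : ℝ) = 75 := by
    have h4 : (4 : R2) = C (4 : ℝ) := (map_ofNat C 4).symm
    have h75 : (75 : R2) = C (75 : ℝ) := (map_ofNat C 75).symm
    rw [h4, h75, ← C_mul]
    norm_num
  simp only [Q, q, u, map_add, map_sub, map_neg, Derivation.leibniz, Derivation.leibniz_pow,
    smul_eq_mul, nsmul_eq_mul, Derivation.map_one_eq_zero, hnum, pderiv_C]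
  push_cast
  linear_combination (-h ^ 3 * pderiv i h) * hC

/-- The Jacobian determinant identity for the van den Essen Pinchuk map. -/
theorem pinchuk_jacobian_identity :
    MvPolynomial.pderiv 0 P * MvPolynomial.pderiv 1 Q -
      MvPolynomial.pderiv 1 P * MvPolynomial.pderiv 0 Q =
    t ^ 2 + (t + f * (13 + 15 * h)) ^ 2 + f ^ 2 := by
  have hth := jacobian_t_h
  have htf := jacobian_t_f
  have hhf := jacobian_h_f
  simp only [jacobian] at hth htf hhf
  simp only [pderiv_P, pderiv_Q]
  linear_combination (2 * t + 6 * h * (h + 1)) * (hth + htf) +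
    (6 * t * (2 * h + 1) + 170 * f + 182 * h + 390 * f * h + 207 * h ^ 2 +
      225 * f * h ^ 2 + 75 * h ^ 3 - (170 * h + 195 * h ^ 2 + 75 * h ^ 3)) * hhf +
    18 * (h + 1) * f_mul_h_sub_t
end
end

section
/- For every point (a,b) ∈ ℝ², the evaluation at (a,b) of the Jacobian determinant (∂P/∂x)·(∂Q/∂y) − (∂P/∂y)·(∂Q/∂x) of the van den Essen Pinchuk map is strictly positive. -/
noncomputable section

/-- The Jacobian determinant of the Pinchuk map as a sum of three squares. -/
theorem jacobian_eval (a b : ℝ) :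
    MvPolynomial.eval ![a, b]
      (MvPolynomial.pderiv 0 P * MvPolynomial.pderiv 1 Q -
        MvPolynomial.pderiv 1 P * MvPolynomial.pderiv 0 Q) =
      MvPolynomial.eval ![a, b] t ^ 2 +
        (MvPolynomial.eval ![a, b] t +
          MvPolynomial.eval ![a, b] f * (13 + 15 * MvPolynomial.eval ![a, b] h)) ^ 2 +
        MvPolynomial.eval ![a, b] f ^ 2 := by
  have hofNat (i : Fin 2) (n : ℕ) [n.AtLeastTwo] :
      MvPolynomial.pderiv i (OfNat.ofNat n : R2) = 0 :=
    Derivation.map_natCast _ n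
  simp [P, Q, q, u, f, h, t, x, y, hofNat, MvPolynomial.pderiv_X, Derivation.leibniz,
    Derivation.leibniz_pow]
  ring

/-- The Jacobian determinant of the van den Essen Pinchuk map is everywhere positive. -/
theorem pinchuk_jacobian_pos (a b : ℝ) :
    0 < MvPolynomial.eval ![a, b]
      (MvPolynomial.pderiv 0 P * MvPolynomial.pderiv 1 Q -
        MvPolynomial.pderiv 1 P * MvPolynomial.pderiv 0 Q) := by
  rw [jacobian_eval]
  by_cases ht : a * b - 1 = 0
  · have hb : b ≠ 0 := by
      rintro rfl
      simp at ht
    have hf : MvPolynomial.eval ![a, b] f = b := by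
      simp [f, t, x, y, ht]
    rw [hf]
    positivity
  · have ht' : MvPolynomial.eval ![a, b] t ≠ 0 := by
      simpa [t, x, y] using ht
    positivity
end
end

section
/- In the field L = FractionRing (MvPolynomial (Fin 2) ℝ) with variables C, H, define X = (C−H)(H+1)/(C−2H−H²)² and Y = (C−2H−H²)²(C−H−H²)/(C−H)² (the denominators are images of nonzero polynomials, hence nonzero). Then substituting (X, Y) for (x, y) in the polynomial P yields C, and substituting (X, Y) for (x, y) in the polynomial h yields H; that is, MvPolynomial.aeval along x ↦ X, y ↦ Y sends P to the image of C and h to the image of H. -/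
noncomputable section

abbrev L : Type := FractionRing (MvPolynomial (Fin 2) ℝ)

/-- The image of the first variable `C` in `L`. -/
def Cvar : L := algebraMap (MvPolynomial (Fin 2) ℝ) L (MvPolynomial.X 0)

/-- The image of the second variable `H` in `L`. -/
def Hvar : L := algebraMap (MvPolynomial (Fin 2) ℝ) L (MvPolynomial.X 1)

/-- X = (C−H)(H+1)/(C−2H−H²)². -/
def Xelt : L := (Cvar - Hvar) * (Hvar + 1) / (Cvar - 2 * Hvar - Hvar ^ 2) ^ 2

/-- Y = (C−2H−H²)²(C−H−H²)/(C−H)². -/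
def Yelt : L :=
  (Cvar - 2 * Hvar - Hvar ^ 2) ^ 2 * (Cvar - Hvar - Hvar ^ 2) / (Cvar - Hvar) ^ 2

/-- A polynomial that does not vanish at some point has nonzero image in `L`. -/
theorem algebraMap_ne_zero_of_eval_ne_zero (p : MvPolynomial (Fin 2) ℝ) (v : Fin 2 → ℝ)
    (hp : MvPolynomial.eval v p ≠ 0) : algebraMap (MvPolynomial (Fin 2) ℝ) L p ≠ 0 := by
  rw [Ne, FaithfulSMul.algebraMap_eq_zero_iff]
  rintro rfl
  simp at hp

theorem Cvar_sub_Hvar_ne_zero : Cvar - Hvar ≠ 0 := by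
  rw [Cvar, Hvar, ← map_sub]
  exact algebraMap_ne_zero_of_eval_ne_zero _ ![1, 0] (by simp)

theorem Cvar_sub_Hvar_mul_two_sub_sq_ne_zero : Cvar - Hvar * 2 - Hvar ^ 2 ≠ 0 := by
  rw [Cvar, Hvar, ← map_ofNat (algebraMap (MvPolynomial (Fin 2) ℝ) L) 2, ← map_mul, ← map_pow,
    ← map_sub, ← map_sub]
  exact algebraMap_ne_zero_of_eval_ne_zero _ ![1, 0] (by simp)

theorem aeval_t : MvPolynomial.aeval ![Xelt, Yelt] t =
    Hvar * (Cvar - 2 * Hvar - Hvar ^ 2) / (Cvar - Hvar) := by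
  have hE := Cvar_sub_Hvar_ne_zero
  have hD := Cvar_sub_Hvar_mul_two_sub_sq_ne_zero
  simp only [t, x, y, map_sub, map_mul, map_one, MvPolynomial.aeval_X, Matrix.cons_val_zero,
    Matrix.cons_val_one, Xelt, Yelt]
  field_simp
  ring

theorem aeval_x_mul_t_add_one : MvPolynomial.aeval ![Xelt, Yelt] (x * t + 1) =
    (Cvar - Hvar) / (Cvar - 2 * Hvar - Hvar ^ 2) := by
  have hE := Cvar_sub_Hvar_ne_zero
  have hD := Cvar_sub_Hvar_mul_two_sub_sq_ne_zero
  rw [map_add, map_mul, aeval_t]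
  simp only [x, map_one, MvPolynomial.aeval_X, Matrix.cons_val_zero, Xelt]
  field_simp
  ring

theorem aeval_h : MvPolynomial.aeval ![Xelt, Yelt] h = Hvar := by
  have hE := Cvar_sub_Hvar_ne_zero
  have hD := Cvar_sub_Hvar_mul_two_sub_sq_ne_zero
  rw [h, map_mul, aeval_x_mul_t_add_one, aeval_t]
  field_simp

theorem aeval_f : MvPolynomial.aeval ![Xelt, Yelt] f = Cvar - Hvar := by
  have hE := Cvar_sub_Hvar_ne_zero
  have hD := Cvar_sub_Hvar_mul_two_sub_sq_ne_zero
  rw [f, map_mul, map_pow, aeval_x_mul_t_add_one, map_add, map_pow, aeval_t]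
  simp only [y, MvPolynomial.aeval_X, Matrix.cons_val_one, Matrix.cons_val_zero, Yelt]
  field_simp
  ring

/-- Substituting the rational parametrization of the level set `P = C` into `P` gives `C`,
and into `h` gives `H`. -/
theorem pinchuk_level_set_parametrization :
    MvPolynomial.aeval ![Xelt, Yelt] P = Cvar ∧
    MvPolynomial.aeval ![Xelt, Yelt] h = Hvar := by
  refine ⟨?_, aeval_h⟩
  rw [P, map_add, aeval_f, aeval_h, sub_add_cancel]
end
end

section
/- In K, the elements f − h − h² and f are nonzero, and the following identities hold: x = f·(h+1)/(f − h − h²)² and y = (f − h − h²)²·(f − h²)/f². -/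
noncomputable section

abbrev K : Type := FractionRing (MvPolynomial (Fin 2) ℝ)

/-- The canonical image of a polynomial in the rational function field `K = ℝ(x,y)`. -/
def ι : R2 →+* K := algebraMap R2 K

theorem xy_eq : x * y = t + 1 := by
  unfold t
  ring

theorem f_sub_h_sub_h_sq : f - h - h ^ 2 = (x * t + 1) * (t ^ 2 + y) := by
  unfold f h
  linear_combination (x * t + 1) * t * xy_eq

theorem h_add_one : h + 1 = x * (t ^ 2 + y) := by
  unfold h
  linear_combination -xy_eq

theorem f_sub_h_sq : f - h ^ 2 = (x * t + 1) ^ 2 * y := by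
  unfold f h
  ring

theorem f_ne_zero : f ≠ 0 := by
  intro hf
  have := congrArg (MvPolynomial.eval fun _ => (0 : ℝ)) hf
  simp [f, t, x, y] at this

theorem ι_injective : Function.Injective ι :=
  IsFractionRing.injective R2 K

theorem ι_ne_zero {p : R2} (hp : p ≠ 0) : ι p ≠ 0 :=
  (map_ne_zero_iff ι ι_injective).mpr hp

/-- In `K = ℝ(x,y)`: `f − h − h²` and `f` are nonzero, and
`x = f(h+1)/(f−h−h²)²`, `y = (f−h−h²)²(f−h²)/f²`. -/
theorem pinchuk_xy_in_terms_of_fh :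
    ι f - ι h - ι h ^ 2 ≠ 0 ∧ ι f ≠ 0 ∧
    ι x = ι f * (ι h + 1) / (ι f - ι h - ι h ^ 2) ^ 2 ∧
    ι y = (ι f - ι h - ι h ^ 2) ^ 2 * (ι f - ι h ^ 2) / (ι f) ^ 2 := by
  have hd : f - h - h ^ 2 ≠ 0 := by
    rw [f_sub_h_sub_h_sq]
    intro h0
    apply f_ne_zero
    unfold f
    linear_combination (x * t + 1) * h0
  have hd' : ι f - ι h - ι h ^ 2 ≠ 0 := by
    simpa only [map_sub, map_pow] using ι_ne_zero hd
  have hf : ι f ≠ 0 := ι_ne_zero f_ne_zero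
  refine ⟨hd', hf, ?_, ?_⟩
  · rw [eq_div_iff (pow_ne_zero 2 hd')]
    have key : x * (f - h - h ^ 2) ^ 2 = f * (h + 1) := by
      rw [f_sub_h_sub_h_sq, h_add_one]
      unfold f
      ring
    simpa only [map_sub, map_pow, map_mul, map_add, map_one] using congrArg ι key
  · rw [eq_div_iff (pow_ne_zero 2 hf)]
    have key : y * f ^ 2 = (f - h - h ^ 2) ^ 2 * (f - h ^ 2) := by
      rw [f_sub_h_sub_h_sq, f_sub_h_sq]
      unfold f
      ring
    simpa only [map_sub, map_pow, map_mul] using congrArg ι key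
end
end

section
/- The intermediate field of K over ℝ generated by the two elements f and h is all of K; that is, ℝ⟮f, h⟯ = ⊤, so ℝ(x,y) = ℝ(f,h). -/
noncomputable section

theorem IntermediateField.eq_top_of_algebraMap_X_mem {F σ E : Type*} [Field F] [Field E]
    [Algebra (MvPolynomial σ F) E] [IsFractionRing (MvPolynomial σ F) E] [Algebra F E]
    [IsScalarTower F (MvPolynomial σ F) E] (L : IntermediateField F E)
    (hL : ∀ i, algebraMap (MvPolynomial σ F) E (MvPolynomial.X i) ∈ L) : L = ⊤ := by
  have mem_of_poly (p : MvPolynomial σ F) : algebraMap (MvPolynomial σ F) E p ∈ L := by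
    induction p using MvPolynomial.induction_on with
    | C a =>
      rw [← MvPolynomial.algebraMap_eq, ← IsScalarTower.algebraMap_apply]
      exact L.algebraMap_mem a
    | add p q hp hq => rw [map_add]; exact add_mem hp hq
    | mul_X p i hp => rw [map_mul]; exact mul_mem hp (hL i)
  refine eq_top_iff.2 fun z _ => ?_
  obtain ⟨a, b, -, rfl⟩ := IsFractionRing.div_surjective (A := MvPolynomial σ F) z
  exact div_mem (mem_of_poly a) (mem_of_poly b)

theorem x_ne_zero : x ≠ 0 := MvPolynomial.X_ne_zero 0

theorem t_ne_zero : t ≠ 0 := fun ht => by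
  simpa [t, x, y] using congrArg (MvPolynomial.eval ![0, 1]) ht

/-- `t` is determined by `f` and `h` through an equation that is linear in `t`. -/
theorem t_mul_f : t * f = h * (f - h ^ 2 - h) := by
  unfold f h t
  ring

/-- `ℝ(x,y) = ℝ(f,h)`: the intermediate field of `K` over `ℝ` generated by `f` and `h`
is all of `K`. -/
theorem pinchuk_K_eq_adjoin_f_h :
    IntermediateField.adjoin ℝ ({ι f, ι h} : Set K) = ⊤ := by
  set L := IntermediateField.adjoin ℝ ({ι f, ι h} : Set K)
  have hf : ι f ∈ L := IntermediateField.subset_adjoin _ _ (by simp)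
  have hh : ι h ∈ L := IntermediateField.subset_adjoin _ _ (by simp)
  have hx0 : ι x ≠ 0 := (map_ne_zero_iff ι ι_injective).2 x_ne_zero
  have ht0 : ι t ≠ 0 := (map_ne_zero_iff ι ι_injective).2 t_ne_zero
  have hf0 : ι f ≠ 0 := (map_ne_zero_iff ι ι_injective).2 f_ne_zero
  have ht : ι t ∈ L := by
    have e : ι t = ι h * (ι f - ι h ^ 2 - ι h) / ι f := by
      rw [eq_div_iff hf0]
      simpa only [map_mul, map_sub, map_pow] using congrArg ι t_mul_f
    rw [e]
    exact div_mem (mul_mem hh (sub_mem (sub_mem hf (pow_mem hh 2)) hh)) hf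
  have hx : ι x ∈ L := by
    have e : ι x = (ι h / ι t - 1) / ι t := by
      have e' : ι h = ι t * (ι x * ι t + 1) := by simp [h]
      rw [e']
      field_simp
      ring
    rw [e]
    exact div_mem (sub_mem (div_mem hh ht) (one_mem L)) ht
  have hy : ι y ∈ L := by
    have e : ι y = (ι t + 1) / ι x := by
      rw [eq_div_iff hx0]
      simp [t, mul_comm]
    rw [e]
    exact div_mem (add_mem ht (one_mem L)) hx
  exact L.eq_top_of_algebraMap_X_mem (Fin.forall_fin_two.2 ⟨hx, hy⟩)
end
end

section
/- The polynomial h is integral over the ℝ-subalgebra Algebra.adjoin ℝ {P, Q} of ℝ[x,y]. -/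
noncomputable section

theorem f_mul_t : f * t = f * h - h ^ 2 * (h + 1) := by
  simp only [f, h, t]
  ring

theorem sq_f_mul_q : f ^ 2 * q =
    -h ^ 2 * ((f - h * (h + 1)) ^ 2 + 6 * f * (f - h * (h + 1)) * (h + 1)) := by
  unfold q
  linear_combination
    (-(f * t) - (f * h - h ^ 2 * (h + 1)) - 6 * f * h * (h + 1)) * f_mul_t

/-- A sextic equation for `h` with coefficients in `ℤ[P, Q]` and constant leading coefficient. -/
theorem h_sextic :
    197 * h ^ 6 = (726 * P - 416) * h ^ 5 + (-825 * P ^ 2 + 1684 * P - 252) * h ^ 4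
      + (300 * P ^ 3 - 2040 * P ^ 2 + 1224 * P) * h ^ 3
      + (4 * Q + 780 * P ^ 3 - 1648 * P ^ 2) * h ^ 2
      + (680 * P ^ 3 - 8 * P * Q) * h + 4 * P ^ 2 * Q := by
  have hC : 4 * (MvPolynomial.C (75 / 4 : ℝ) : R2) = 75 := by
    rw [← map_ofNat MvPolynomial.C 4, ← map_mul, ← map_ofNat MvPolynomial.C 75]
    norm_num
  simp only [P, Q, u]
  linear_combination (-4) * sq_f_mul_q + f ^ 2 * h ^ 4 * hC

/-- A root of a sextic over `A` whose leading coefficient is invertible in `A` is integral. -/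
theorem isIntegral_of_sextic {A B : Type*} [CommRing A] [CommRing B] [Algebra A B]
    {z : B} (a : A) (ha : 197 * a = 1) (c₀ c₁ c₂ c₃ c₄ c₅ : A)
    (hz : 197 * z ^ 6 = algebraMap A B c₅ * z ^ 5 + algebraMap A B c₄ * z ^ 4
      + algebraMap A B c₃ * z ^ 3 + algebraMap A B c₂ * z ^ 2 + algebraMap A B c₁ * z
      + algebraMap A B c₀) :
    IsIntegral A z := by
  nontriviality A
  have ha_map : 197 * algebraMap A B a = 1 := by
    simpa only [map_mul, map_ofNat, map_one] using congrArg (algebraMap A B) ha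
  refine ⟨.X ^ 6 - (.C (a * c₅) * .X ^ 5 + .C (a * c₄) * .X ^ 4 + .C (a * c₃) * .X ^ 3
    + .C (a * c₂) * .X ^ 2 + .C (a * c₁) * .X + .C (a * c₀)), ?_, ?_⟩
  · apply Polynomial.monic_X_pow_sub
    refine lt_of_le_of_lt (b := 5) (by compute_degree) (by norm_num)
  · simp only [Polynomial.eval₂_sub, Polynomial.eval₂_add, Polynomial.eval₂_mul,
      Polynomial.eval₂_pow, Polynomial.eval₂_X, Polynomial.eval₂_C, map_mul]
    linear_combination algebraMap A B a * hz - z ^ 6 * ha_map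

/-- `h` is integral over the `ℝ`-subalgebra of `ℝ[x,y]` generated by `P` and `Q`. -/
theorem pinchuk_h_integral :
    IsIntegral (Algebra.adjoin ℝ ({P, Q} : Set R2)) h := by
  let p : Algebra.adjoin ℝ ({P, Q} : Set R2) := ⟨P, Algebra.subset_adjoin (by simp)⟩
  let r : Algebra.adjoin ℝ ({P, Q} : Set R2) := ⟨Q, Algebra.subset_adjoin (by simp)⟩
  have hp : algebraMap _ R2 p = P := rfl
  have hr : algebraMap _ R2 r = Q := rfl
  refine isIntegral_of_sextic (algebraMap ℝ _ (1 / 197)) ?_ (4 * p ^ 2 * r)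
    (680 * p ^ 3 - 8 * p * r) (4 * r + 780 * p ^ 3 - 1648 * p ^ 2)
    (300 * p ^ 3 - 2040 * p ^ 2 + 1224 * p) (-825 * p ^ 2 + 1684 * p - 252)
    (726 * p - 416) ?_
  · rw [← map_ofNat (algebraMap ℝ (Algebra.adjoin ℝ ({P, Q} : Set R2))) 197, ← map_mul]
    norm_num
  · simp only [map_add, map_sub, map_mul, map_neg, map_pow, map_ofNat, hp, hr]
    exact h_sextic
end
end

section
/- There exists a nonzero polynomial g ∈ MvPolynomial (Fin 2) ℝ such that for every (a,b) ∈ ℝ² with g evaluated at (a,b) nonzero: (i) the fiber F⁻¹({(a,b)}) consists of exactly two distinct points v and v'; and (ii) the univariate real polynomial R_{a,b}(T) = (197/4)T⁶ + (104 − (363/2)a)T⁵ + (63 − 421a + (825/4)a²)T⁴ + (−306a + 510a² − 75a³)T³ + (−b + 412a² − 195a³)T² + (2ab − 170a³)T − a²b has exactly two real roots, both of multiplicity one, and those roots are the evaluations of the polynomial h at v and at v'. -/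
noncomputable section

/-- The van den Essen Pinchuk map as a map `ℝ² → ℝ²`. -/
def F (p : ℝ × ℝ) : ℝ × ℝ :=
  (MvPolynomial.eval ![p.1, p.2] P, MvPolynomial.eval ![p.1, p.2] Q)

/-- The univariate polynomial `R_{a,b}(T)`. -/
def Rab (a b : ℝ) : Polynomial ℝ :=
  Polynomial.C (197 / 4) * Polynomial.X ^ 6 +
    Polynomial.C (104 - (363 / 2) * a) * Polynomial.X ^ 5 +
    Polynomial.C (63 - 421 * a + (825 / 4) * a ^ 2) * Polynomial.X ^ 4 +
    Polynomial.C (-306 * a + 510 * a ^ 2 - 75 * a ^ 3) * Polynomial.X ^ 3 +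
    Polynomial.C (-b + 412 * a ^ 2 - 195 * a ^ 3) * Polynomial.X ^ 2 +
    Polynomial.C (2 * a * b - 170 * a ^ 3) * Polynomial.X +
    Polynomial.C (-(a ^ 2) * b)

/-- The value of `R_{a,b}` at a real number, in expanded form. -/
lemma eval_Rab (a b T : ℝ) : (Rab a b).eval T =
    197 / 4 * T ^ 6 + (104 - 363 / 2 * a) * T ^ 5 + (63 - 421 * a + 825 / 4 * a ^ 2) * T ^ 4 +
      (-306 * a + 510 * a ^ 2 - 75 * a ^ 3) * T ^ 3 + (-b + 412 * a ^ 2 - 195 * a ^ 3) * T ^ 2 +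
      (2 * a * b - 170 * a ^ 3) * T + -(a ^ 2) * b := by
  simp [Rab]

/-- The numerator of the derivative of `R_{a,b}(T) / (a - T)²` is minus a sum of squares. -/
lemma derivative_Rab_identity (a b T : ℝ) :
    (a - T) * (Rab a b).derivative.eval T + 2 * (Rab a b).eval T =
      -((T * (a - 2 * T - T ^ 2)) ^ 2 +
        (T * (a - 2 * T - T ^ 2) + (a - T) ^ 2 * (13 + 15 * T)) ^ 2 + (a - T) ^ 4) := by
  rw [eval_Rab]
  simp [Rab, Polynomial.derivative_pow]
  ring

lemma derivative_Rab_identity_neg (a b : ℝ) {T : ℝ} (hT : T ≠ a) :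
    (a - T) * (Rab a b).derivative.eval T + 2 * (Rab a b).eval T < 0 := by
  rw [derivative_Rab_identity]
  have : 0 < (a - T) ^ 4 := by
    have : a - T ≠ 0 := sub_ne_zero.2 hT.symm
    positivity
  nlinarith [sq_nonneg (T * (a - 2 * T - T ^ 2)),
    sq_nonneg (T * (a - 2 * T - T ^ 2) + (a - T) ^ 2 * (13 + 15 * T))]

lemma hasDerivAt_Rab_div (a b : ℝ) {T : ℝ} (hT : T ≠ a) :
    HasDerivAt (fun s => (Rab a b).eval s / (a - s) ^ 2)
      (((a - T) * (Rab a b).derivative.eval T + 2 * (Rab a b).eval T) / (a - T) ^ 3) T := by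
  have hne : a - T ≠ 0 := sub_ne_zero.2 hT.symm
  have hd : HasDerivAt (fun s : ℝ => (a - s) ^ 2) (2 * (a - T) * (-1)) T := by
    simpa using! ((hasDerivAt_id T).const_sub a).pow 2
  refine (((Rab a b).hasDerivAt T).fun_div hd (pow_ne_zero 2 hne)).congr_deriv ?_
  rw [div_eq_div_iff (pow_ne_zero 2 (pow_ne_zero 2 hne)) (pow_ne_zero 3 hne)]
  ring

lemma Rab_root_unique_right {a b T T' : ℝ} (hT : a < T) (hT' : a < T')
    (hr : (Rab a b).eval T = 0) (hr' : (Rab a b).eval T' = 0) : T = T' := by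
  have hmono : StrictMonoOn (fun s => (Rab a b).eval s / (a - s) ^ 2) (Set.Ioi a) := by
    refine strictMonoOn_of_deriv_pos (convex_Ioi a)
      (fun s hs => (hasDerivAt_Rab_div a b (ne_of_gt hs)).continuousAt.continuousWithinAt) ?_
    intro s hs
    rw [interior_Ioi] at hs
    rw [(hasDerivAt_Rab_div a b (ne_of_gt hs)).deriv]
    exact div_pos_of_neg_of_neg (derivative_Rab_identity_neg a b (ne_of_gt hs))
      (Odd.pow_neg (by decide) (sub_neg.2 hs))
  exact hmono.injOn hT hT' (by simp [hr, hr'])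

lemma Rab_root_unique_left {a b T T' : ℝ} (hT : T < a) (hT' : T' < a)
    (hr : (Rab a b).eval T = 0) (hr' : (Rab a b).eval T' = 0) : T = T' := by
  have hanti : StrictAntiOn (fun s => (Rab a b).eval s / (a - s) ^ 2) (Set.Iio a) := by
    refine strictAntiOn_of_deriv_neg (convex_Iio a)
      (fun s hs => (hasDerivAt_Rab_div a b (ne_of_lt hs)).continuousAt.continuousWithinAt) ?_
    intro s hs
    rw [interior_Iio] at hs
    rw [(hasDerivAt_Rab_div a b (ne_of_lt hs)).deriv]
    exact div_neg_of_neg_of_pos (derivative_Rab_identity_neg a b (ne_of_lt hs))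
      (pow_pos (sub_pos.2 hs) 3)
  exact hanti.injOn hT hT' (by simp [hr, hr'])

open Polynomial Filter in
/-- A real sextic with leading coefficient `197/4` takes positive values arbitrarily far right. -/
lemma exists_gt_sextic_pos (c₅ c₄ c₃ c₂ c₁ c₀ A : ℝ) : ∃ T, A < T ∧
    0 < 197 / 4 * T ^ 6 + c₅ * T ^ 5 + c₄ * T ^ 4 + c₃ * T ^ 3 + c₂ * T ^ 2 + c₁ * T + c₀ := by
  set p : ℝ[X] := C (197 / 4) * X ^ 6 + C c₅ * X ^ 5 + C c₄ * X ^ 4 + C c₃ * X ^ 3 + C c₂ * X ^ 2 +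
    C c₁ * X + C c₀ with hp
  have hdeg : p.natDegree = 6 := by
    rw [hp]; compute_degree!
  have hlead : p.leadingCoeff = 197 / 4 := by
    rw [leadingCoeff, hdeg, hp]
    simp
  have htend := p.tendsto_atTop_of_leadingCoeff_nonneg
    (natDegree_pos_iff_degree_pos.1 (by omega)) (by rw [hlead]; norm_num)
  obtain ⟨T, h1, h2⟩ := ((eventually_gt_atTop A).and (htend.eventually_gt_atTop 0)).exists
  exact ⟨T, h1, by simpa [hp] using h2⟩

lemma exists_Rab_root_right {a b : ℝ} (ha : (Rab a b).eval a < 0) :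
    ∃ T, a < T ∧ (Rab a b).eval T = 0 := by
  obtain ⟨M, haM, hM⟩ := exists_gt_sextic_pos (104 - 363 / 2 * a)
    (63 - 421 * a + 825 / 4 * a ^ 2) (-306 * a + 510 * a ^ 2 - 75 * a ^ 3)
    (-b + 412 * a ^ 2 - 195 * a ^ 3) (2 * a * b - 170 * a ^ 3) (-(a ^ 2) * b) a
  rw [← eval_Rab] at hM
  obtain ⟨T, hT, hr⟩ := intermediate_value_Ioo haM.le (Rab a b).continuousOn ⟨ha, hM⟩
  exact ⟨T, hT.1, hr⟩

lemma exists_Rab_root_left {a b : ℝ} (ha : (Rab a b).eval a < 0) :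
    ∃ T, T < a ∧ (Rab a b).eval T = 0 := by
  obtain ⟨M, haM, hM⟩ := exists_gt_sextic_pos (-(104 - 363 / 2 * a))
    (63 - 421 * a + 825 / 4 * a ^ 2) (-(-306 * a + 510 * a ^ 2 - 75 * a ^ 3))
    (-b + 412 * a ^ 2 - 195 * a ^ 3) (-(2 * a * b - 170 * a ^ 3)) (-(a ^ 2) * b) (-a)
  have hM' : 0 < (Rab a b).eval (-M) := by
    rw [eval_Rab]; convert hM using 1; ring
  obtain ⟨T, hT, hr⟩ :=
    intermediate_value_Ioo' (neg_lt.1 haM).le (Rab a b).continuousOn ⟨ha, hM'⟩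
  exact ⟨T, hT.2, hr⟩

lemma Rab_eval_self_neg {a : ℝ} (b : ℝ) (h0 : a ≠ 0) (h1 : a + 1 ≠ 0) :
    (Rab a b).eval a < 0 := by
  have he : (Rab a b).eval a = -(a ^ 2 * (a + 1)) ^ 2 := by rw [eval_Rab]; ring
  rw [he]
  have : 0 < (a ^ 2 * (a + 1)) ^ 2 := by positivity
  linarith

lemma roots_Rab_nodup {a b : ℝ} (ha : (Rab a b).eval a ≠ 0) : (Rab a b).roots.Nodup := by
  have hne : Rab a b ≠ 0 := by rintro h0; simp [h0] at ha
  rw [Multiset.nodup_iff_count_le_one]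
  intro T
  rw [Polynomial.count_roots]
  by_contra! hlt
  obtain ⟨hr, hr'⟩ := (Polynomial.one_lt_rootMultiplicity_iff_isRoot hne).1 hlt
  have hT : T ≠ a := by rintro rfl; exact ha hr
  have := derivative_Rab_identity_neg a b hT
  rw [hr.eq_zero, hr'.eq_zero] at this
  simp at this

lemma eval_h (p : ℝ × ℝ) : MvPolynomial.eval ![p.1, p.2] h =
    (p.1 * p.2 - 1) * (p.1 * (p.1 * p.2 - 1) + 1) := by
  simp [h, t, x, y]

lemma F_fst (p : ℝ × ℝ) : (F p).1 =
    (p.1 * (p.1 * p.2 - 1) + 1) ^ 2 * ((p.1 * p.2 - 1) ^ 2 + p.2) +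
      MvPolynomial.eval ![p.1, p.2] h := by
  simp [F, P, f, h, t, x, y]

/-- The product `t * f` as a polynomial in `P` and `h`. -/
lemma t_mul_f_s7 (p : ℝ × ℝ) {T : ℝ} (hT : MvPolynomial.eval ![p.1, p.2] h = T) :
    (p.1 * p.2 - 1) * ((F p).1 - T) = T * ((F p).1 - 2 * T - T ^ 2) := by
  rw [← hT, F_fst, eval_h]; ring

lemma F_snd (p : ℝ × ℝ) {T : ℝ} (hT : MvPolynomial.eval ![p.1, p.2] h = T) : (F p).2 =
    -(p.1 * p.2 - 1) ^ 2 - 6 * (p.1 * p.2 - 1) * T * (T + 1) -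
      (170 * ((F p).1 - T) * T + 91 * T ^ 2 + 195 * ((F p).1 - T) * T ^ 2 + 69 * T ^ 3 +
        75 * ((F p).1 - T) * T ^ 3 + 75 / 4 * T ^ 4) := by
  have hf : MvPolynomial.eval ![p.1, p.2] f = (F p).1 - T := by
    rw [← hT]; simp [F, P]
  have ht : MvPolynomial.eval ![p.1, p.2] t = p.1 * p.2 - 1 := by simp [t, x, y]
  rw [← hf, ← ht, ← hT]
  simp [F, Q, q, u]

/-- `R_{a,b}(T) = (a - T)² (q - u - b)` when `s` is the value of `t` determined by `a` and `T`. -/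
lemma eval_Rab_eq {a T s : ℝ} (b : ℝ) (hs : s * (a - T) = T * (a - 2 * T - T ^ 2)) :
    (Rab a b).eval T = (a - T) ^ 2 * (-s ^ 2 - 6 * s * T * (T + 1) -
      (170 * (a - T) * T + 91 * T ^ 2 + 195 * (a - T) * T ^ 2 + 69 * T ^ 3 +
        75 * (a - T) * T ^ 3 + 75 / 4 * T ^ 4) - b) := by
  rw [eval_Rab]
  linear_combination (s * (a - T) + T * (a - 2 * T - T ^ 2) + 6 * (a - T) * T * (T + 1)) * hs

lemma eval_Rab_of_F_eq {a b : ℝ} {p : ℝ × ℝ} (hp : F p = (a, b)) :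
    (Rab a b).eval (MvPolynomial.eval ![p.1, p.2] h) = 0 := by
  have h1 := t_mul_f_s7 p rfl
  have h2 := F_snd p rfl
  rw [hp] at h1 h2
  rw [eval_Rab_eq b h1, ← h2, sub_self, mul_zero]

/-- The preimage under `F` of `(a, b)` at which `h` takes the value `T`. -/
def fiberPoint (a T : ℝ) : ℝ × ℝ :=
  ((a - T) * (1 + T) / (a - 2 * T - T ^ 2) ^ 2,
    (a - T - T ^ 2) * (a - 2 * T - T ^ 2) ^ 2 / (a - T) ^ 2)

lemma eq_fiberPoint {p : ℝ × ℝ} {T : ℝ} (hT : MvPolynomial.eval ![p.1, p.2] h = T)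
    (hne : T ≠ (F p).1) : p = fiberPoint (F p).1 T := by
  have hf : (F p).1 - T ≠ 0 := sub_ne_zero.2 hne.symm
  have hA : (p.1 * (p.1 * p.2 - 1) + 1) * ((F p).1 - 2 * T - T ^ 2) = (F p).1 - T := by
    rw [← hT, F_fst, eval_h]; ring
  have hd : (F p).1 - 2 * T - T ^ 2 ≠ 0 := by
    intro h0
    rw [h0, mul_zero] at hA
    exact hf hA.symm
  refine Prod.ext ?_ ?_
  · rw [fiberPoint, eq_div_iff (pow_ne_zero 2 hd), ← hT, F_fst, eval_h]; ring
  · rw [fiberPoint, eq_div_iff (pow_ne_zero 2 hf), ← hT, F_fst, eval_h]; ring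

lemma fiberPoint_mul_sub_one {a T : ℝ} (hf : a - T ≠ 0) (hd : a - 2 * T - T ^ 2 ≠ 0) :
    (fiberPoint a T).1 * (fiberPoint a T).2 - 1 = T * (a - 2 * T - T ^ 2) / (a - T) := by
  have hrel : a - 2 * T - T ^ 2 = a - T - T - T ^ 2 := by ring
  rw [fiberPoint]
  generalize a - 2 * T - T ^ 2 = d at *
  generalize a - T = e at *
  field_simp
  rw [hrel]
  ring

lemma fiberPoint_fst_mul_add_one {a T : ℝ} (hf : a - T ≠ 0) (hd : a - 2 * T - T ^ 2 ≠ 0) :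
    (fiberPoint a T).1 * ((fiberPoint a T).1 * (fiberPoint a T).2 - 1) + 1 =
      (a - T) / (a - 2 * T - T ^ 2) := by
  rw [fiberPoint_mul_sub_one hf hd, fiberPoint]
  have hrel : a - 2 * T - T ^ 2 = a - T - T - T ^ 2 := by ring
  generalize a - 2 * T - T ^ 2 = d at *
  generalize a - T = e at *
  field_simp
  rw [hrel]
  ring

lemma eval_h_fiberPoint {a T : ℝ} (hf : a - T ≠ 0) (hd : a - 2 * T - T ^ 2 ≠ 0) :
    MvPolynomial.eval ![(fiberPoint a T).1, (fiberPoint a T).2] h = T := by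
  rw [eval_h, fiberPoint_fst_mul_add_one hf hd, fiberPoint_mul_sub_one hf hd]
  generalize a - 2 * T - T ^ 2 = d at *
  generalize a - T = e at *
  field_simp

lemma F_fiberPoint {a b T : ℝ} (hf : a - T ≠ 0) (hd : a - 2 * T - T ^ 2 ≠ 0)
    (hr : (Rab a b).eval T = 0) : F (fiberPoint a T) = (a, b) := by
  have hh := eval_h_fiberPoint hf hd
  have h1 : (F (fiberPoint a T)).1 = a := by
    rw [F_fst, hh, fiberPoint_fst_mul_add_one hf hd, fiberPoint_mul_sub_one hf hd, fiberPoint,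
      ← eq_sub_iff_add_eq]
    generalize a - 2 * T - T ^ 2 = d at *
    generalize a - T = e at *
    field_simp
    ring
  have h2 := F_snd _ hh
  have ht := t_mul_f_s7 _ hh
  rw [h1] at h2 ht
  rw [eval_Rab_eq b ht, ← h2] at hr
  refine Prod.ext h1 (sub_eq_zero.1 ?_)
  exact (mul_eq_zero.1 hr).resolve_left (pow_ne_zero 2 hf)

/-- A polynomial vanishing wherever the fiber of `F` may fail to consist of two points. -/
def badLocus : R2 :=
  x * (x + 1) *
    ((y - (MvPolynomial.C (45 / 4) * x ^ 2 + 52 * x)) ^ 2 -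
      2 * (75 * x ^ 2 + 179 * x + 104) * (y - (MvPolynomial.C (45 / 4) * x ^ 2 + 52 * x)) -
      x * (75 * x ^ 2 + 179 * x + 104) ^ 2)

lemma eval_badLocus (a b : ℝ) : MvPolynomial.eval ![a, b] badLocus =
    a * (a + 1) * ((b - (45 / 4 * a ^ 2 + 52 * a)) ^ 2 -
      2 * (75 * a ^ 2 + 179 * a + 104) * (b - (45 / 4 * a ^ 2 + 52 * a)) -
      a * (75 * a ^ 2 + 179 * a + 104) ^ 2) := by
  simp [badLocus, x, y]

lemma badLocus_ne_zero : badLocus ≠ 0 := by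
  intro h0
  have h1 := eval_badLocus 1 0
  rw [h0, map_zero] at h1
  norm_num at h1

lemma sub_sub_ne_zero_of_root {a b T : ℝ} (hg : MvPolynomial.eval ![a, b] badLocus ≠ 0)
    (hf : a - T ≠ 0) (hr : (Rab a b).eval T = 0) : a - 2 * T - T ^ 2 ≠ 0 := by
  intro hd
  obtain rfl : a = 2 * T + T ^ 2 := by linarith
  rw [eval_Rab_eq (s := 0) b (by rw [hd]; ring)] at hr
  have hb := (mul_eq_zero.1 hr).resolve_left (pow_ne_zero 2 hf)
  apply hg
  rw [eval_badLocus]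
  obtain rfl := (sub_eq_zero.1 hb).symm
  ring

/-- For generic `(a,b)`, the fiber of `F` consists of exactly two points `v ≠ v'`, and
`R_{a,b}` has exactly two real roots, both simple, namely `h(v)` and `h(v')`. -/
theorem pinchuk_generic_fibers :
    ∃ g : R2, g ≠ 0 ∧ ∀ a b : ℝ, MvPolynomial.eval ![a, b] g ≠ 0 →
      ∃ v v' : ℝ × ℝ, v ≠ v' ∧ F ⁻¹' {(a, b)} = {v, v'} ∧
        MvPolynomial.eval ![v.1, v.2] h ≠ MvPolynomial.eval ![v'.1, v'.2] h ∧
        (Rab a b).roots =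
          {MvPolynomial.eval ![v.1, v.2] h, MvPolynomial.eval ![v'.1, v'.2] h} := by
  refine ⟨badLocus, badLocus_ne_zero, fun a b hg => ?_⟩
  have hg' := hg
  rw [eval_badLocus] at hg'
  have hneg : (Rab a b).eval a < 0 :=
    Rab_eval_self_neg b (left_ne_zero_of_mul (left_ne_zero_of_mul hg'))
      (right_ne_zero_of_mul (left_ne_zero_of_mul hg'))
  obtain ⟨T, hT, hr⟩ := exists_Rab_root_left hneg
  obtain ⟨T', hT', hr'⟩ := exists_Rab_root_right hneg
  have hroot : ∀ s, (Rab a b).eval s = 0 ↔ s = T ∨ s = T' := by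
    refine fun s => ⟨fun hs => ?_, by rintro (rfl | rfl) <;> assumption⟩
    rcases lt_trichotomy s a with hlt | rfl | hgt
    · exact Or.inl (Rab_root_unique_left hlt hT hs hr)
    · exact absurd hs hneg.ne
    · exact Or.inr (Rab_root_unique_right hgt hT' hs hr')
  have hf : a - T ≠ 0 := (sub_pos.2 hT).ne'
  have hf' : a - T' ≠ 0 := (sub_neg.2 hT').ne
  have hd := sub_sub_ne_zero_of_root hg hf hr
  have hd' := sub_sub_ne_zero_of_root hg hf' hr'
  have hh := eval_h_fiberPoint hf hd
  have hh' := eval_h_fiberPoint hf' hd'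
  have hTT' : T ≠ T' := (hT.trans hT').ne
  refine ⟨fiberPoint a T, fiberPoint a T', fun heq => ?_, ?_, ?_, ?_⟩
  · rw [heq, hh'] at hh
    exact hTT' hh.symm
  · ext p
    simp only [Set.mem_preimage, Set.mem_singleton_iff, Set.mem_insert_iff]
    constructor
    · intro hp
      have hs := eval_Rab_of_F_eq hp
      have hpa : (F p).1 = a := by rw [hp]
      rcases (hroot _).1 hs with hs | hs
      · exact Or.inl (hpa ▸ eq_fiberPoint hs (by rw [hpa]; exact hT.ne))
      · exact Or.inr (hpa ▸ eq_fiberPoint hs (by rw [hpa]; exact hT'.ne'))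
    · rintro (rfl | rfl)
      · exact F_fiberPoint hf hd hr
      · exact F_fiberPoint hf' hd' hr'
  · rwa [hh, hh']
  · rw [hh, hh']
    have hne : Rab a b ≠ 0 := by
      intro h0
      simp [h0] at hneg
    refine ((roots_Rab_nodup hneg.ne).ext (by simpa using hTT')).2 fun s => ?_
    simp [Polynomial.mem_roots hne, Polynomial.IsRoot.def, hroot]
end
end

section
/- The degree of the minimal polynomial of h over E is not equal to 2; that is, (minpoly E h).natDegree ≠ 2. -/
noncomputable section

/-- The images of `P`, `Q`, `h` in the rational function field `K`. -/
def PK : K := ι P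
def QK : K := ι Q
def hK : K := ι h

/-- `E = ℝ(P,Q)`, the intermediate field of `K` over `ℝ` generated by `P` and `Q`. -/
def E : IntermediateField ℝ K := IntermediateField.adjoin ℝ ({PK, QK} : Set K)

open Polynomial WithZero in
/-- If `w` has a pole of order `4` at infinity, then `X` is not a root of a nonzero polynomial
of degree at most `2` over `k[w]`: the three terms have distinct orders modulo `4`. -/
theorem quadratic_aeval_eq_zero {k : Type*} [Field k] [DecidableEq (RatFunc k)]
    {w : RatFunc k} (hw : RatFunc.inftyValuation k w = exp 4) {a b c : k[X]}
    (habc : aeval w a * RatFunc.X ^ 2 + aeval w b * RatFunc.X + aeval w c = 0) : a = 0 := by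
  by_contra ha
  set v := RatFunc.inftyValuation k
  have hX : v RatFunc.X = exp 1 := RatFunc.inftyValuation.X k
  have hw1 : 1 < v w := by
    rw [hw, ← exp_zero, exp_lt_exp]
    norm_num
  have haeval (r : k[X]) (hr : r ≠ 0) : v (aeval w r) = exp (4 * r.natDegree : ℤ) := by
    rw [valuation_aeval_eq_valuation_X_pow_natDegree_of_one_lt_valuation_X w hw1 hr, hw,
      ← exp_nsmul]
    simp [mul_comm]
  have h2 : v (aeval w a * RatFunc.X ^ 2) = exp (4 * a.natDegree + 2 : ℤ) := by
    rw [map_mul, map_pow, hX, haeval a ha, ← exp_nsmul, ← exp_add]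
    simp
  have h1 (hb : b ≠ 0) : v (aeval w b * RatFunc.X) = exp (4 * b.natDegree + 1 : ℤ) := by
    rw [map_mul, hX, haeval b hb, ← exp_add]
  have hle : v (aeval w b * RatFunc.X + aeval w c) = v (aeval w a * RatFunc.X ^ 2) := by
    rw [← Valuation.map_neg, neg_eq_of_add_eq_zero_left (by rw [← add_assoc, habc])]
  rw [h2] at hle
  rcases eq_or_ne b 0 with rfl | hb
  · rcases eq_or_ne c 0 with rfl | hc
    · simp at hle
    · simp only [map_zero, zero_mul, zero_add, haeval c hc, exp_inj] at hle
      lia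
  · rcases eq_or_ne c 0 with rfl | hc
    · simp only [map_zero, add_zero, h1 hb, exp_inj] at hle
      lia
    · have hne : v (aeval w b * RatFunc.X) ≠ v (aeval w c) := by
        rw [h1 hb, haeval c hc, Ne, exp_inj]
        lia
      rw [Valuation.map_add_of_distinct_val v hne, h1 hb, haeval c hc] at hle
      rcases max_choice (exp (4 * b.natDegree + 1 : ℤ)) (exp (4 * c.natDegree : ℤ)) with hm | hm <;>
      · rw [hm, exp_inj] at hle
        lia

/-- Substituting a rational parametrisation of the curve `P = p` by `h = X`. -/
theorem exists_specialization (p : ℝ) [DecidableEq (RatFunc ℝ)] :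
    ∃ φ : R2 →ₐ[ℝ] RatFunc ℝ, φ P = RatFunc.C p ∧ φ h = RatFunc.X ∧
      RatFunc.inftyValuation ℝ (φ Q) = WithZero.exp 4 := by
  set X : RatFunc ℝ := RatFunc.X with hXdef
  set D : RatFunc ℝ := RatFunc.C p - X with hDdef
  have hpoly (r : Polynomial ℝ) (hr : r ≠ 0) :
      RatFunc.inftyValuation ℝ (algebraMap _ (RatFunc ℝ) r) = WithZero.exp (r.natDegree : ℤ) :=
    RatFunc.inftyValuation.polynomial ℝ hr
  have hne (r : Polynomial ℝ) (n : ℕ) (hr : r.natDegree = n + 1) :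
      algebraMap _ (RatFunc ℝ) r ≠ 0 := by
    rw [Ne, FaithfulSMul.algebraMap_eq_zero_iff]
    rintro rfl
    simp at hr
  have hX : X ≠ 0 := RatFunc.X_ne_zero
  have hX1 : X + 1 ≠ 0 := by
    convert hne (.X + 1) 0 (by compute_degree!) using 1
    simp [hXdef]
  have hDpoly : D = algebraMap _ (RatFunc ℝ) (Polynomial.C p - .X) := by simp [hDdef, hXdef]
  have hDdeg : (Polynomial.C p - .X).natDegree = 1 := by compute_degree!
  have hD : D ≠ 0 := hDpoly ▸ hne _ 0 hDdeg
  set T : RatFunc ℝ := X - X ^ 2 * (X + 1) / D with hTdef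
  have hTD : T * D = X * D - X ^ 2 * (X + 1) := by rw [hTdef]; field_simp
  have hT : T ≠ 0 := by
    refine left_ne_zero_of_mul (b := D) ?_
    rw [hTD]
    convert hne (.X * (Polynomial.C p - .X) - .X ^ 2 * (.X + 1)) 2 (by compute_degree!) using 1
    simp [hXdef, hDdef]
  have hXT : X - T = X ^ 2 * (X + 1) / D := by rw [hTdef]; ring
  have hXT0 : X - T ≠ 0 := by rw [hXT]; positivity
  let φ : R2 →ₐ[ℝ] RatFunc ℝ :=
    MvPolynomial.aeval ![(X - T) / T ^ 2, (T + 1) * T ^ 2 / (X - T)]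
  have hx : φ x = (X - T) / T ^ 2 := by simp [φ, x]
  have hy : φ y = (T + 1) * T ^ 2 / (X - T) := by simp [φ, y]
  have ht : φ t = T := by
    simp only [t, map_sub, map_mul, map_one, hx, hy]
    field_simp
    ring
  have hxt : φ x * T + 1 = X / T := by
    rw [hx]
    field_simp
    ring
  have hh : φ h = X := by
    simp only [h, map_add, map_mul, map_one, ht, hxt]
    field_simp
  have hf : φ f = D := by
    have : φ f = X ^ 2 * (X + 1) / (X - T) := by
      simp only [f, map_add, map_mul, map_one, map_pow, ht, hxt, hy]
      field_simp
      ring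
    rw [this, hXT]
    field_simp
  refine ⟨φ, by rw [P, map_add, hf, hh, hDdef, sub_add_cancel], hh, ?_⟩
  let d : Polynomial ℝ := .C p - .X
  let N : Polynomial ℝ :=
    (.X ^ 2 * (.X + 1) - .X * d) * (.X * d - .X ^ 2 * (.X + 1)) - 6 * (.X * d - .X ^ 2 * (.X + 1)) * d * .X * (.X + 1)
      - (170 * d * .X + 91 * .X ^ 2 + 195 * d * .X ^ 2 + 69 * .X ^ 3 + 75 * d * .X ^ 3
          + .C (75 / 4) * .X ^ 4) * d ^ 2
  have hN : N.natDegree = 6 := by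
    simp only [N, d]
    compute_degree!
  have hQ : φ Q * D ^ 2 = algebraMap _ (RatFunc ℝ) N := by
    have hC : φ (MvPolynomial.C (75 / 4)) = RatFunc.C (75 / 4) := by simp [φ]
    have hNφ : algebraMap _ (RatFunc ℝ) N =
        -(T * D) ^ 2 - 6 * (T * D) * D * X * (X + 1)
          - (170 * D * X + 91 * X ^ 2 + 195 * D * X ^ 2 + 69 * X ^ 3 + 75 * D * X ^ 3
            + RatFunc.C (75 / 4) * X ^ 4) * D ^ 2 := by
      rw [hTD]
      simp only [N, d, hDdef, map_sub, map_mul, map_add, map_pow, map_one,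
        RatFunc.algebraMap_X, RatFunc.algebraMap_C, map_ofNat, hXdef]
      ring
    rw [hNφ]
    simp only [Q, q, u, map_sub, map_neg, map_mul, map_add, map_pow, map_one, map_ofNat, hC, ht,
      hh, hf]
    ring
  have hv := congrArg (RatFunc.inftyValuation ℝ) hQ
  rw [map_mul, map_pow, hDpoly, hpoly _ (by rintro h0; simp [h0] at hDdeg),
    hpoly _ (by rintro h0; simp [h0] at hN), hDdeg, hN] at hv
  refine mul_right_cancel₀ (pow_ne_zero 2 WithZero.exp_ne_zero) (hv.trans ?_)
  rw [← WithZero.exp_nsmul, ← WithZero.exp_add]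
  norm_num

/-- `h` satisfies no nontrivial quadratic relation over `ℝ[P, Q]`. -/
theorem quadratic_relation_eq_zero {A B C : MvPolynomial (Fin 2) ℝ}
    (hrel : MvPolynomial.aeval ![P, Q] A * h ^ 2 + MvPolynomial.aeval ![P, Q] B * h
      + MvPolynomial.aeval ![P, Q] C = 0) : A = 0 := by
  classical
  refine MvPolynomial.funext fun z ↦ ?_
  obtain ⟨φ, hP, hh, hQ⟩ := exists_specialization (z 0)
  let fiber : MvPolynomial (Fin 2) ℝ →ₐ[ℝ] Polynomial ℝ :=
    MvPolynomial.aeval ![.C (z 0), .X]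
  have hφ : φ.comp (MvPolynomial.aeval ![P, Q]) = (Polynomial.aeval (φ Q)).comp fiber := by
    ext i
    fin_cases i <;> simp [fiber, hP]
  have hφ' (r) : φ (MvPolynomial.aeval ![P, Q] r) = Polynomial.aeval (φ Q) (fiber r) :=
    DFunLike.congr_fun hφ r
  have hzero := congrArg φ hrel
  simp only [map_add, map_mul, map_pow, map_zero, hφ', hh] at hzero
  have hA : fiber A = 0 := quadratic_aeval_eq_zero hQ hzero
  have heval : (Polynomial.aeval (z 1)).comp fiber = MvPolynomial.aeval z := by
    ext i
    fin_cases i <;> simp [fiber]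
  have := DFunLike.congr_fun heval A
  simpa [hA] using this.symm

/-- Elements of `E` are quotients of polynomials in `P` and `Q`. -/
theorem exists_mul_eq_of_mem_E {e : K} (he : e ∈ E) :
    ∃ r s : MvPolynomial (Fin 2) ℝ, ι (MvPolynomial.aeval ![P, Q] s) ≠ 0 ∧
      e * ι (MvPolynomial.aeval ![P, Q] s) = ι (MvPolynomial.aeval ![P, Q] r) := by
  have hι (r : MvPolynomial (Fin 2) ℝ) :
      MvPolynomial.aeval ![PK, QK] r = ι (MvPolynomial.aeval ![P, Q] r) := by
    have : MvPolynomial.aeval ![PK, QK] =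
        (IsScalarTower.toAlgHom ℝ R2 K).comp (MvPolynomial.aeval ![P, Q]) := by
      ext i
      fin_cases i <;> simp [PK, QK, ι]
    exact DFunLike.congr_fun this r
  rw [E, ← Matrix.range_cons_cons_empty PK QK ![], IntermediateField.mem_adjoin_range_iff] at he
  obtain ⟨r, s, rfl⟩ := he
  rw [hι, hι]
  by_cases hs : ι (MvPolynomial.aeval ![P, Q] s) = 0
  · exact ⟨0, 1, by simp, by rw [hs]; simp⟩
  · exact ⟨r, s, hs, div_mul_cancel₀ _ hs⟩

/-- The degree of the minimal polynomial of `h` over `E = ℝ(P,Q)` is not `2`. -/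
theorem pinchuk_minpoly_degree_ne_two :
    (minpoly E hK).natDegree ≠ 2 := by
  intro hdeg
  have hint : IsIntegral E hK := by
    by_contra hint
    simp [minpoly.eq_zero hint] at hdeg
  have hlead : (minpoly E hK).coeff 2 = 1 := by
    simpa [Polynomial.Monic, Polynomial.leadingCoeff, hdeg] using minpoly.monic hint
  have hroot := minpoly.aeval E hK
  rw [Polynomial.aeval_eq_sum_range, hdeg] at hroot
  simp only [Finset.sum_range_succ, Finset.sum_range_zero, hlead, Algebra.smul_def,
    IntermediateField.algebraMap_apply, pow_zero, pow_one, mul_one, zero_add,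
    OneMemClass.coe_one, one_mul] at hroot
  obtain ⟨r₀, s₀, hs₀, h₀⟩ := exists_mul_eq_of_mem_E ((minpoly E hK).coeff 0).2
  obtain ⟨r₁, s₁, hs₁, h₁⟩ := exists_mul_eq_of_mem_E ((minpoly E hK).coeff 1).2
  have hzero : s₀ * s₁ = 0 := by
    refine quadratic_relation_eq_zero (B := r₁ * s₀) (C := r₀ * s₁) ?_
    refine IsFractionRing.injective R2 K ?_
    change ι _ = ι _
    simp only [map_add, map_mul, map_pow, map_zero, ← h₀, ← h₁]
    change _ * _ * hK ^ 2 + _ * hK + _ = 0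
    linear_combination ι (MvPolynomial.aeval ![P, Q] s₀) * ι (MvPolynomial.aeval ![P, Q] s₁) * hroot
  rcases mul_eq_zero.mp hzero with rfl | rfl
  · simp at hs₀
  · simp at hs₁
end
end

section
/- The minimal polynomial of h over E is exactly M(T) := T⁶ + (4/197)(104 − (363/2)P)T⁵ + (4/197)(63 − 421P + (825/4)P²)T⁴ + (4/197)(−306P + 510P² − 75P³)T³ + (4/197)(−Q + 412P² − 195P³)T² + (4/197)(2PQ − 170P³)T − (4/197)P²Q, where the displayed coefficients are the indicated polynomial expressions in P and Q regarded as elements of E; that is, minpoly E h = M. -/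
noncomputable section

/-- `P` as an element of `E`. -/
def pE : E := ⟨PK, IntermediateField.subset_adjoin ℝ _ (Set.mem_insert _ _)⟩

/-- `Q` as an element of `E`. -/
def qE : E := ⟨QK, IntermediateField.subset_adjoin ℝ _ (Set.mem_insert_of_mem _ rfl)⟩

/-- The monic polynomial `M(T) = (4/197)·R(T)` with coefficients in `E`. -/
def M : Polynomial E :=
  Polynomial.X ^ 6 +
    Polynomial.C ((4 / 197) * (104 - (363 / 2) * pE)) * Polynomial.X ^ 5 +
    Polynomial.C ((4 / 197) * (63 - 421 * pE + (825 / 4) * pE ^ 2)) * Polynomial.X ^ 4 +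
    Polynomial.C ((4 / 197) * (-306 * pE + 510 * pE ^ 2 - 75 * pE ^ 3)) * Polynomial.X ^ 3 +
    Polynomial.C ((4 / 197) * (-qE + 412 * pE ^ 2 - 195 * pE ^ 3)) * Polynomial.X ^ 2 +
    Polynomial.C ((4 / 197) * (2 * pE * qE - 170 * pE ^ 3)) * Polynomial.X -
    Polynomial.C ((4 / 197) * (pE ^ 2 * qE))

open Polynomial Polynomial.Bivariate in
/-- A polynomial `a(Y) - X b(Y)` that is linear in `X` with relatively prime coefficients is
irreducible. -/
theorem irreducible_map_C_sub_C_X_mul_map_C {R : Type*} [CommRing R] [IsDomain R] {a b : R[X]}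
    (hb : b ≠ 0) (hab : IsRelPrime a b) :
    Irreducible (a.map C - C X * b.map C : R[X][Y]) := by
  rw [← MulEquiv.irreducible_iff (Bivariate.swap (R := R))]
  have key : Bivariate.swap (a.map C - C X * b.map C : R[X][Y]) = C (-b) * X + C a := by
    rw [map_sub, map_mul, Bivariate.swap_map_C, Bivariate.swap_map_C, Bivariate.swap_X, C_neg]
    ring
  rw [key]
  exact irreducible_C_mul_X_add_C (neg_ne_zero.mpr hb) hab.symm.neg_left

open Polynomial in
/-- Relative primality to a power of a monic linear polynomial is tested at its root. -/
theorem isRelPrime_C_mul_X_sub_C_pow {R : Type*} [CommRing R] [IsDomain R]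
    [UniqueFactorizationMonoid R] {a : R[X]} {c r : R}
    (hc : IsUnit c) (n : ℕ) (ha : a.eval r ≠ 0) : IsRelPrime a (C c * (X - C r) ^ n) := by
  refine (isRelPrime_mul_unit_left_right (hc.map C)).mpr (IsRelPrime.pow_right ?_)
  refine ((irreducible_X_sub_C r).isRelPrime_iff_not_dvd.mpr ?_).symm
  rwa [dvd_iff_isRoot]

/-- The part of `M` free of `Q`, as a polynomial in `T` over `ℝ[P]`. -/
def constPart : Polynomial (Polynomial ℝ) :=
  Polynomial.X ^ 6 +
    Polynomial.C (Polynomial.C (4 / 197) * (104 - Polynomial.C (363 / 2) * Polynomial.X)) *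
      Polynomial.X ^ 5 +
    Polynomial.C (Polynomial.C (4 / 197) * (63 - 421 * Polynomial.X +
      Polynomial.C (825 / 4) * Polynomial.X ^ 2)) * Polynomial.X ^ 4 +
    Polynomial.C (Polynomial.C (4 / 197) * (-306 * Polynomial.X + 510 * Polynomial.X ^ 2 -
      75 * Polynomial.X ^ 3)) * Polynomial.X ^ 3 +
    Polynomial.C (Polynomial.C (4 / 197) * (412 * Polynomial.X ^ 2 - 195 * Polynomial.X ^ 3)) *
      Polynomial.X ^ 2 +
    Polynomial.C (Polynomial.C (4 / 197) * (-170 * Polynomial.X ^ 3)) * Polynomial.X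

/-- The coefficient of `-Q` in `M`, as a polynomial in `T` over `ℝ[P]`. -/
def linearPart : Polynomial (Polynomial ℝ) :=
  Polynomial.C (Polynomial.C (4 / 197)) * (Polynomial.X - Polynomial.C Polynomial.X) ^ 2

/-- The polynomial `M` over the polynomial ring `ℝ[P][Q]`. -/
def MPoly : Polynomial (Polynomial (Polynomial ℝ)) :=
  constPart.map Polynomial.C - Polynomial.C Polynomial.X * linearPart.map Polynomial.C

theorem constPart_eval_X_ne_zero : constPart.eval Polynomial.X ≠ 0 := by
  intro h0
  have h1 := congrArg (Polynomial.eval 1) h0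
  simp [constPart] at h1
  norm_num at h1

theorem irreducible_MPoly : Irreducible MPoly := by
  have hc : IsUnit (Polynomial.C (4 / 197 : ℝ)) :=
    Polynomial.isUnit_C.mpr (isUnit_iff_ne_zero.mpr (by norm_num))
  refine irreducible_map_C_sub_C_X_mul_map_C ?_
    (isRelPrime_C_mul_X_sub_C_pow hc 2 constPart_eval_X_ne_zero)
  exact mul_ne_zero (by simp) (pow_ne_zero _ (Polynomial.X_sub_C_ne_zero _))

/-- Evaluation of polynomials in `ℝ[P][Q]` inside the field `E`. -/
def evalE : Polynomial (Polynomial ℝ) →ₐ[ℝ] E := Polynomial.aevalAeval pE qE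

theorem M_eq_map : M = MPoly.map evalE.toRingHom := by
  simp [M, MPoly, constPart, linearPart, evalE, Polynomial.map_sub, map_ofNat]
  ring

theorem monic_M : M.Monic := by
  unfold M
  monicity!

theorem four_mul_u : 4 * u = 4 * (170 * f * h + 91 * h ^ 2 + 195 * f * h ^ 2 + 69 * h ^ 3 +
    75 * f * h ^ 3) + 75 * h ^ 4 := by
  have hC : (4 : R2) * MvPolynomial.C (75 / 4 : ℝ) = 75 := by
    rw [← map_ofNat (MvPolynomial.C (σ := Fin 2) (R := ℝ)) 4, ← map_mul,
      ← map_ofNat (MvPolynomial.C (σ := Fin 2) (R := ℝ)) 75]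
    norm_num
  unfold u
  linear_combination h ^ 4 * hC

theorem PK_eq : PK = ι f + ι h := map_add ι f h

theorem ι_f_mul_h_sub_t : ι f * (ι h - ι t) = ι h ^ 2 * (ι h + 1) := by
  simpa using congrArg ι f_mul_h_sub_t

theorem aeval_hK_M : Polynomial.aeval hK M = 0 := by
  have e1 := ι_f_mul_h_sub_t
  have e2 := congrArg ι four_mul_u
  simp only [map_mul, map_add, map_pow, map_ofNat] at e2
  have hQ : QK = -ι t ^ 2 - 6 * ι t * ι h * (ι h + 1) - ι u := by simp [QK, Q, q, map_ofNat]
  have hp : algebraMap E K pE = PK := rfl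
  have hq : algebraMap E K qE = QK := rfl
  simp only [M, map_mul, map_add, map_sub, map_neg, map_pow, map_div₀, map_ofNat,
    Polynomial.aeval_X, Polynomial.aeval_C, hp, hq, hQ, PK_eq, hK]
  linear_combination (4 / 197) * (-(ι t * ι f + ι h * ι f - ι h ^ 2 * (ι h + 1)) -
    6 * ι h * (ι h + 1) * ι f) * e1 + (1 / 197) * ι f ^ 2 * e2

theorem ι_ne_zero_of_eval_ne_zero {p : R2} (v : Fin 2 → ℝ) (hp : MvPolynomial.eval v p ≠ 0) :
    ι p ≠ 0 := by
  rw [map_ne_zero_iff ι ι_injective]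
  rintro rfl
  exact hp (map_zero _)

/-- `K` is generated by `P` and `h`: the only intermediate field containing both is `K` itself. -/
theorem eq_top_of_PK_mem_of_hK_mem {F : Type*} [Field F] [Algebra F K] [Algebra ℝ F]
    [IsScalarTower ℝ F K] {L : IntermediateField F K}
    (hP : PK ∈ L) (hh : hK ∈ L) : L = ⊤ := by
  have hf0 : ι f ≠ 0 := ι_ne_zero_of_eval_ne_zero ![1, 2] (by norm_num [f, t, x, y])
  have ht0 : ι t ≠ 0 := ι_ne_zero_of_eval_ne_zero ![1, 2] (by norm_num [t, x, y])
  have hx0 : ι x ≠ 0 := ι_ne_zero_of_eval_ne_zero ![1, 2] (by norm_num [x])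
  have hh : ι h ∈ L := hh
  have hf : ι f ∈ L := by simpa [PK_eq] using sub_mem hP hh
  have ht : ι t ∈ L := by
    have e : ι t = ι h - ι h ^ 2 * (ι h + 1) / ι f := by
      field_simp
      linear_combination -ι_f_mul_h_sub_t
    rw [e]
    exact sub_mem hh (div_mem (mul_mem (pow_mem hh 2) (add_mem hh (one_mem L))) hf)
  have hx : ι x ∈ L := by
    have e : ι x = (ι h - ι t) / ι t ^ 2 := by
      rw [eq_div_iff (pow_ne_zero 2 ht0), ← map_pow, ← map_mul, ← map_sub]
      congr 1
      unfold h
      ring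
    rw [e]
    exact div_mem (sub_mem hh ht) (pow_mem ht 2)
  have hy : ι y ∈ L := by
    have e : ι y = (ι t + 1) / ι x := by
      rw [eq_div_iff hx0, ← map_one ι, ← map_mul, ← map_add]
      congr 1
      unfold t
      ring
    rw [e]
    exact div_mem (add_mem ht (one_mem L)) hx
  have hι (p : R2) : ι p ∈ L := by
    induction p using MvPolynomial.induction_on with
    | C a =>
      have e : ι (MvPolynomial.C a) = algebraMap F K (algebraMap ℝ F a) := by
        rw [← IsScalarTower.algebraMap_apply ℝ F K, IsScalarTower.algebraMap_apply ℝ R2 K]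
        rfl
      rw [e]
      exact L.algebraMap_mem _
    | add p q hp hq => rw [map_add]; exact add_mem hp hq
    | mul_X p i hp =>
      rw [map_mul]
      refine mul_mem hp ?_
      fin_cases i
      exacts [hx, hy]
  refine top_le_iff.mp fun z _ ↦ ?_
  obtain ⟨a, b, -, rfl⟩ := IsFractionRing.div_surjective (A := R2) z
  exact div_mem (hι a) (hι b)

theorem isAlgebraic_E_K : Algebra.IsAlgebraic E K := by
  rw [← algebraicClosure.eq_top_iff]
  refine eq_top_of_PK_mem_of_hK_mem ?_ ?_
  · exact IntermediateField.algebraMap_mem _ pE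
  · exact mem_algebraicClosure_iff.mpr ⟨M, monic_M.ne_zero, aeval_hK_M⟩

open scoped IntermediateField.algebraAdjoinAdjoin in
theorem isAlgebraic_algebraAdjoin {F L : Type*} [Field F] [Field L] [Algebra F L] {S : Set L}
    (hS : Algebra.IsAlgebraic (IntermediateField.adjoin F S) L) :
    Algebra.IsAlgebraic (Algebra.adjoin F S) L :=
  (IsFractionRing.comap_isAlgebraic_iff (K := IntermediateField.adjoin F S)).mpr hS

theorem algebraicIndependent_PK_QK : AlgebraicIndependent ℝ ![PK, QK] := by
  have hrange : Set.range ![PK, QK] = {PK, QK} := by simp [Set.pair_comm]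
  have halg : Algebra.IsAlgebraic (Algebra.adjoin ℝ (Set.range ![PK, QK])) K := by
    rw [hrange]
    exact isAlgebraic_algebraAdjoin isAlgebraic_E_K
  refine (Algebra.IsAlgebraic.isTranscendenceBasis_of_le_trdeg_of_finite ℝ _ ?_).1
  calc Cardinal.mk (Fin 2) = Algebra.trdeg ℝ R2 := by simp
    _ ≤ Algebra.trdeg ℝ K :=
      trdeg_le_of_injective (IsScalarTower.toAlgHom ℝ R2 K) ι_injective

theorem val_comp_evalE :
    E.val.comp evalE = (MvPolynomial.aeval ![PK, QK]).comp
      (Polynomial.Bivariate.equivMvPolynomial ℝ).toAlgHom := by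
  ext <;> simp [evalE, pE, qE]

theorem evalE_injective : Function.Injective evalE := by
  refine Function.Injective.of_comp (f := E.val) ?_
  rw [← AlgHom.coe_comp, val_comp_evalE]
  exact Function.Injective.comp (g := MvPolynomial.aeval ![PK, QK]) algebraicIndependent_PK_QK
    (Polynomial.Bivariate.equivMvPolynomial ℝ).injective

theorem exists_evalE_div_eq (z : E) : ∃ a b, z = evalE a / evalE b := by
  have hle : Algebra.adjoin ℝ {PK, QK} ≤ (E.val.comp evalE).range := by
    refine Algebra.adjoin_le ?_
    rintro _ (rfl | rfl)
    · exact ⟨Polynomial.C Polynomial.X, by simp [evalE, pE]⟩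
    · exact ⟨Polynomial.X, by simp [evalE, qE]⟩
  obtain ⟨r, hr, s, hs, hz⟩ := IntermediateField.mem_adjoin_iff_div.mp z.2
  obtain ⟨a, rfl⟩ := hle hr
  obtain ⟨b, rfl⟩ := hle hs
  exact ⟨a, b, Subtype.ext hz⟩

/-- The minimal polynomial of `h` over `E = ℝ(P,Q)` is exactly `M`. -/
theorem pinchuk_minpoly_eq : minpoly E hK = M := by
  let : Algebra (Polynomial (Polynomial ℝ)) E := evalE.toRingHom.toAlgebra
  have : FaithfulSMul (Polynomial (Polynomial ℝ)) E :=
    (faithfulSMul_iff_algebraMap_injective _ _).mpr evalE_injective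
  have hfrac : IsFractionRing (Polynomial (Polynomial ℝ)) E := .of_field _ _ exists_evalE_div_eq
  have hmonic : MPoly.Monic :=
    Polynomial.monic_of_injective (f := evalE.toRingHom) evalE_injective (M_eq_map ▸ monic_M)
  refine (minpoly.eq_of_irreducible_of_monic ?_ aeval_hK_M monic_M).symm
  rw [M_eq_map]
  exact (hmonic.irreducible_iff_irreducible_map_fraction_map (K := E)).mp irreducible_MPoly
end
end

section
/- The field extension E ⊆ K has degree six: Module.finrank E K = 6. -/
noncomputable section

namespace RatFunc

open Polynomial _root_.IntermediateField

/-- If the numerator and denominator of a fraction are coprime polynomials, the fraction has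
the expected degree as a generator of a subfield of the rational function field. -/
theorem finrank_adjoin_div {k : Type*} [Field k] {p d : k[X]} (hd : d ≠ 0)
    (hpd : IsCoprime p d) :
    Module.finrank k⟮(algebraMap k[X] (RatFunc k) p / algebraMap k[X] (RatFunc k) d)⟯ (RatFunc k) =
      max p.natDegree d.natDegree := by
  rw [finrank_eq_max_natDegree]
  set g : RatFunc k := algebraMap k[X] (RatFunc k) p / algebraMap k[X] (RatFunc k) d with hg
  have hcross : g.num * d = p * g.denom := num_mul_eq_mul_denom_iff hd |>.mpr hg
  have hnum : Associated g.num p :=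
    associated_of_dvd_dvd (num_div_dvd p hd) (hpd.dvd_of_dvd_mul_right ⟨g.denom, hcross⟩)
  have hdenom : Associated g.denom d :=
    associated_of_dvd_dvd (denom_div_dvd p d)
      (hpd.symm.dvd_of_dvd_mul_left ⟨g.num, by rw [← hcross, mul_comm]⟩)
  rw [natDegree_eq_of_degree_eq (degree_eq_degree_of_associated hnum),
    natDegree_eq_of_degree_eq (degree_eq_degree_of_associated hdenom)]

end RatFunc

section SimpleTranscendental

open Polynomial _root_.IntermediateField

/-- The degree of `k(θ)` over the subfield generated by a reduced fraction in `θ`. -/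
theorem finrank_adjoin_aeval_div {k L : Type*} [Field k] [Field L] [Algebra k L] {θ : L}
    (hθ : Transcendental k θ) (htop : k⟮θ⟯ = ⊤) {p d : k[X]} (hd : d ≠ 0) (hpd : IsCoprime p d) :
    Module.finrank k⟮(aeval θ p / aeval θ d)⟯ L = max p.natDegree d.natDegree := by
  rw [← RatFunc.finrank_adjoin_div hd hpd]
  let e : RatFunc k ≃ₐ[k] L :=
    (RatFunc.algEquivOfTranscendental θ hθ).trans ((equivOfEq htop).trans topEquiv)
  have he (r : k[X]) : e (algebraMap k[X] (RatFunc k) r) = aeval θ r := by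
    simp only [e, AlgEquiv.trans_apply, RatFunc.algEquivOfTranscendental_algebraMap]
    change ((aeval (AdjoinSimple.gen k θ) r : k⟮θ⟯) : L) = aeval θ r
    simp
  set g : RatFunc k := algebraMap k[X] (RatFunc k) p / algebraMap k[X] (RatFunc k) d
  have heg : e g = aeval θ p / aeval θ d := by simp only [g, map_div₀, he]
  have hmap : (k⟮g⟯).map (e : RatFunc k →ₐ[k] L) = k⟮(aeval θ p / aeval θ d)⟯ := by
    rw [adjoin_map, Set.image_singleton, ← heg]
    rfl
  refine (Algebra.finrank_eq_of_equiv_equiv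
    ((intermediateFieldMap e k⟮g⟯).trans (equivOfEq hmap)).toRingEquiv e.toRingEquiv ?_).symm
  ext z
  rfl

end SimpleTranscendental

section PinchukIdentities

variable {F : Type*} [Field F] {a b T : F}

/-- The rational inverse of `(x, y) ↦ (P, h)`, with `T` in the role of `t`. -/
theorem pinchuk_inverse (hT : T ≠ 0) (hbT : b - T ≠ 0)
    (h_eq : T * (a - b) = b * (a - 2 * b - b ^ 2)) :
    let X := (b - T) / T ^ 2
    let Y := (T + 1) / X
    let t' := X * Y - 1
    t' * (X * t' + 1) = b ∧ (X * t' + 1) ^ 2 * (t' ^ 2 + Y) + t' * (X * t' + 1) = a := by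
  intro X Y t'
  have hX : X ≠ 0 := div_ne_zero hbT (pow_ne_zero 2 hT)
  have ht : t' = T := by simp only [t', Y]; field_simp; ring
  have hs : X * T + 1 = b / T := by simp only [X]; field_simp; ring
  rw [ht, hs]
  refine ⟨by field_simp, ?_⟩
  simp only [Y, X]
  field_simp
  linear_combination h_eq

variable {X Y : F}

theorem pinchuk_t_eq (hs : X * (X * Y - 1) + 1 ≠ 0) (hy : (X * Y - 1) ^ 2 + Y ≠ 0) :
    let t' := X * Y - 1
    let h' := t' * (X * t' + 1)
    let P' := (X * t' + 1) ^ 2 * (t' ^ 2 + Y) + h'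
    t' = h' * (P' - 2 * h' - h' ^ 2) / (P' - h') := by
  intro t' h' P'
  have hP : P' - h' ≠ 0 := by
    simp only [P', add_sub_cancel_right]
    exact mul_ne_zero (pow_ne_zero 2 hs) hy
  rw [eq_div_iff hP]
  simp only [P', h', t']
  ring

end PinchukIdentities

section Pinchuk

open IntermediateField

theorem ι_ne_zero_of_eval {p : R2} (v : Fin 2 → ℝ) (hv : MvPolynomial.eval v p ≠ 0) :
    ι p ≠ 0 := by
  intro h0
  have hp : p = 0 := IsFractionRing.injective R2 K (by simpa [ι] using h0)
  exact hv (by simp [hp])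

theorem algebraicIndependent_P_h : AlgebraicIndependent ℝ ![P, h] := by
  set a : K := ι x
  set b : K := ι y
  have hb0 : b ≠ 0 := ι_ne_zero_of_eval ![0, 1] (by simp [y])
  have hb1 : b + 1 ≠ 0 := by
    have := ι_ne_zero_of_eval (p := y + 1) ![0, 1] (by simp [y])
    simpa using this
  have hab : a - b ≠ 0 := by
    have := ι_ne_zero_of_eval (p := x - y) ![0, 1] (by simp [x, y])
    simpa using this
  have hc : a - 2 * b - b ^ 2 ≠ 0 := by
    have := ι_ne_zero_of_eval (p := x - 2 * y - y ^ 2) ![1, 0] (by simp [x, y])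
    simpa only [map_sub, map_mul, map_pow, map_ofNat] using this
  set T : K := b * (a - 2 * b - b ^ 2) / (a - b)
  have hT : T ≠ 0 := div_ne_zero (mul_ne_zero hb0 hc) hab
  have h_eq : T * (a - b) = b * (a - 2 * b - b ^ 2) := div_mul_cancel₀ _ hab
  have hbT : b - T ≠ 0 := by
    have : (b - T) * (a - b) = b ^ 2 * (b + 1) := by linear_combination -h_eq
    exact left_ne_zero_of_mul (this ▸ mul_ne_zero (pow_ne_zero 2 hb0) hb1)
  obtain ⟨hh, hP⟩ := pinchuk_inverse hT hbT h_eq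
  let φ : R2 →ₐ[ℝ] K := MvPolynomial.aeval ![(b - T) / T ^ 2, (T + 1) / ((b - T) / T ^ 2)]
  have hφh : φ h = b := by
    rw [← hh]; simp [φ, h, t, x, y]
  have hφP : φ P = a := by
    rw [← hP]; simp [φ, P, f, h, t, x, y]
  apply AlgebraicIndependent.of_comp φ
  have hcomp : φ ∘ ![P, h] =
      (IsScalarTower.toAlgHom ℝ R2 K) ∘ (MvPolynomial.X : Fin 2 → R2) := by
    funext i
    fin_cases i
    · exact hφP
    · exact hφh
  rw [hcomp]
  exact (MvPolynomial.algebraicIndependent_X (Fin 2) ℝ).map' (IsFractionRing.injective R2 K)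

theorem algebraicIndependent_PK_hK : AlgebraicIndependent ℝ ![PK, hK] := by
  have := algebraicIndependent_P_h.map' (f := IsScalarTower.toAlgHom ℝ R2 K)
    (IsFractionRing.injective R2 K)
  convert this using 1
  funext i
  fin_cases i <;> rfl

theorem transcendental_PK : Transcendental ℝ PK :=
  algebraicIndependent_PK_hK.transcendental 0

theorem transcendental_hK : Transcendental ℝ⟮PK⟯ hK := by
  rw [transcendental_adjoin_iff]
  have := algebraicIndependent_PK_hK.transcendental_adjoin (s := {0}) (i := 1) (by simp)
  rwa [Set.image_singleton] at this

theorem adjoin_PK_hK : ℝ⟮PK, hK⟯ = ⊤ := by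
  set M := ℝ⟮PK, hK⟯
  have hPM : PK ∈ M := subset_adjoin ℝ _ (by simp)
  have hhM : hK ∈ M := subset_adjoin ℝ _ (by simp)
  have hx0 : ι x ≠ 0 := ι_ne_zero_of_eval ![1, 0] (by simp [x])
  have ht0 : ι t ≠ 0 := ι_ne_zero_of_eval ![0, 0] (by simp [t, x, y])
  have hs0 : ι (x * t + 1) ≠ 0 := ι_ne_zero_of_eval ![0, 0] (by simp [t, x, y])
  have hy0 : ι (t ^ 2 + y) ≠ 0 := ι_ne_zero_of_eval ![0, 0] (by simp [t, x, y])
  have htM : ι t ∈ M := by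
    have key := pinchuk_t_eq (X := ι x) (Y := ι y) (by simpa [t] using hs0) (by simpa [t] using hy0)
    have htK : ι t = hK * (PK - 2 * hK - hK ^ 2) / (PK - hK) := by
      simpa [PK, hK, P, f, h, t] using key
    rw [htK]
    have h2 : (2 : K) ∈ M := ofNat_mem M 2
    exact div_mem (mul_mem hhM (sub_mem (sub_mem hPM (mul_mem h2 hhM)) (pow_mem hhM 2)))
      (sub_mem hPM hhM)
  have hxM : ι x ∈ M := by
    have : ι x = (hK - ι t) / ι t ^ 2 := by
      rw [eq_div_iff (pow_ne_zero 2 ht0)]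
      simp only [hK, h, map_mul, map_add, map_one]
      ring
    rw [this]
    exact div_mem (sub_mem hhM htM) (pow_mem htM 2)
  have hyM : ι y ∈ M := by
    have : ι y = (ι t + 1) / ι x := by
      rw [eq_div_iff hx0]
      simp only [t, map_mul, map_sub, map_one]
      ring
    rw [this]
    exact div_mem (add_mem htM (one_mem M)) hxM
  have hR (p : R2) : ι p ∈ M := by
    induction p using MvPolynomial.induction_on with
    | C r =>
      have : ι (MvPolynomial.C r) = algebraMap ℝ K r :=
        (IsScalarTower.algebraMap_apply ℝ R2 K r).symm
      rw [this]
      exact M.algebraMap_mem r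
    | add p q hp hq => rw [map_add]; exact add_mem hp hq
    | mul_X p i hp =>
      rw [map_mul]
      refine mul_mem hp ?_
      fin_cases i
      · exact hxM
      · exact hyM
  rw [eq_top_iff]
  intro z _
  obtain ⟨p, d, -, rfl⟩ := IsFractionRing.div_surjective (A := R2) z
  exact div_mem (hR p) (hR d)

theorem adjoin_hK : (ℝ⟮PK⟯)⟮hK⟯ = ⊤ := by
  rw [← restrictScalars_eq_top_iff (K := ℝ), adjoin_simple_adjoin_simple, adjoin_PK_hK]

section Fraction

open Polynomial

variable {k : Type*} [Field k]

/-- The numerator of `Q` as a rational function of `h` over `ℝ(P)`, with `c` in the role of `P`. -/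
def pinchukNum (c : k) : k[X] :=
  X ^ 2 * (C c - 2 * X - X ^ 2) * (X ^ 2 + 2 * X - C c) - 6 * X ^ 2 * (X + 1) * (C c - 2 * X - X ^ 2) * (C c - X)
    - (C c - X) ^ 2 * (170 * (C c - X) * X + 91 * X ^ 2 + 195 * (C c - X) * X ^ 2 + 69 * X ^ 3
      + 75 * (C c - X) * X ^ 3 + C (75 / 4) * X ^ 4)

theorem natDegree_pinchukNum [CharZero k] (c : k) : (pinchukNum c).natDegree = 6 := by
  unfold pinchukNum
  compute_degree
  · norm_num
  all_goals norm_num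

theorem natDegree_C_sub_X_sq (c : k) : ((C c - X) ^ 2 : k[X]).natDegree = 2 := by
  compute_degree!

theorem isCoprime_pinchukNum {c : k} (hc : c ≠ 0) (hc1 : c + 1 ≠ 0) :
    IsCoprime (pinchukNum c) ((C c - X) ^ 2) := by
  apply IsCoprime.pow_right
  rw [← neg_sub, IsCoprime.neg_right_iff, isCoprime_comm,
    (irreducible_X_sub_C c).coprime_iff_not_dvd, dvd_iff_isRoot, IsRoot.def]
  have : (pinchukNum c).eval c = -(c ^ 4 * (c + 1) ^ 2) := by
    simp [pinchukNum]; ring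
  rw [this]
  exact neg_ne_zero.mpr (mul_ne_zero (pow_ne_zero 4 hc) (pow_ne_zero 2 hc1))

end Fraction

theorem QK_eq : QK = Polynomial.aeval hK (pinchukNum (AdjoinSimple.gen ℝ PK)) /
    Polynomial.aeval hK ((Polynomial.C (AdjoinSimple.gen ℝ PK) - Polynomial.X) ^ 2) := by
  have hs0 : ι (x * t + 1) ≠ 0 := ι_ne_zero_of_eval ![0, 0] (by simp [t, x, y])
  have hy0 : ι (t ^ 2 + y) ≠ 0 := ι_ne_zero_of_eval ![0, 0] (by simp [t, x, y])
  have hPh : PK - hK ≠ 0 := by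
    have : PK - hK = ι (x * t + 1) ^ 2 * ι (t ^ 2 + y) := by simp [PK, hK, P, f]
    rw [this]
    exact mul_ne_zero (pow_ne_zero 2 hs0) hy0
  have htK : ι t * (PK - hK) = hK * (PK - 2 * hK - hK ^ 2) := by
    have key := pinchuk_t_eq (X := ι x) (Y := ι y) (by simpa [t] using hs0) (by simpa [t] using hy0)
    rw [← eq_div_iff hPh]
    simpa [PK, hK, P, f, h, t] using key
  have hC : ι (MvPolynomial.C (75 / 4 : ℝ)) = 75 / 4 := by
    have : ι (MvPolynomial.C (75 / 4 : ℝ)) = algebraMap ℝ K (75 / 4) :=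
      (IsScalarTower.algebraMap_apply ℝ R2 K _).symm
    rw [this, map_div₀, map_ofNat, map_ofNat]
  have hf : ι f = PK - hK := by simp [PK, hK, P]
  have hQ : QK = -ι t ^ 2 - 6 * ι t * hK * (hK + 1) -
      (170 * (PK - hK) * hK + 91 * hK ^ 2 + 195 * (PK - hK) * hK ^ 2 + 69 * hK ^ 3
        + 75 * (PK - hK) * hK ^ 3 + 75 / 4 * hK ^ 4) := by
    rw [← hf, ← hC]
    simp only [QK, Q, q, u, hK, map_sub, map_add, map_mul, map_neg, map_pow, map_ofNat, map_one]
  have hden : Polynomial.aeval hK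
      ((Polynomial.C (AdjoinSimple.gen ℝ PK) - Polynomial.X) ^ 2) = (PK - hK) ^ 2 := by
    simp
  rw [hden, eq_div_iff (pow_ne_zero 2 hPh), hQ]
  simp only [pinchukNum, map_sub, map_add, map_mul, map_pow, map_ofNat, map_one,
    Polynomial.aeval_C, Polynomial.aeval_X, AdjoinSimple.algebraMap_gen, map_div₀]
  linear_combination (-(ι t * (PK - hK)) - hK * (PK - 2 * hK - hK ^ 2)
    - 6 * hK * (hK + 1) * (PK - hK)) * htK

theorem E_eq_restrictScalars : E = ((ℝ⟮PK⟯)⟮QK⟯).restrictScalars ℝ :=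
  (adjoin_simple_adjoin_simple ℝ PK QK).symm

end Pinchuk

/-- The field extension `ℝ(P,Q) ⊆ ℝ(x,y)` has degree six. -/
theorem pinchuk_finrank_six : Module.finrank E K = 6 := by
  rw [E_eq_restrictScalars]
  change Module.finrank (IntermediateField.adjoin (IntermediateField.adjoin ℝ {PK}) {QK}) K = 6
  have hgen (r : ℝ) : IntermediateField.AdjoinSimple.gen ℝ PK + algebraMap ℝ _ r ≠ 0 := by
    intro h0
    apply transcendental_PK
    have : PK = algebraMap ℝ K (-r) := by
      rw [map_neg]
      exact eq_neg_of_add_eq_zero_left (congrArg Subtype.val h0)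
    rw [this]
    exact isAlgebraic_algebraMap _
  rw [QK_eq, finrank_adjoin_aeval_div transcendental_hK adjoin_hK
    (Polynomial.ne_zero_of_natDegree_gt (n := 1) (by rw [natDegree_C_sub_X_sq]; norm_num))
    (isCoprime_pinchukNum (by simpa using hgen 0) (by simpa using hgen 1)),
    natDegree_pinchukNum, natDegree_C_sub_X_sq]
  rfl
end
end

section
/- For every real number r with r ≠ 0 and r ≠ −2, set x₀ = (−r)(r+1)/(−2r − r²)² and y₀ = (−2r − r²)²(−r − r²)/r² (both well defined since the denominators are nonzero). Then the polynomial P evaluates to 0 at (x₀, y₀), the polynomial h evaluates to r at (x₀, y₀), and the polynomial Q evaluates at (x₀, y₀) to (197/4)r⁴ + 104r³ + 63r², which is strictly positive. -/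
noncomputable section

theorem eval_t (v : Fin 2 → ℝ) : MvPolynomial.eval v t = v 0 * v 1 - 1 := by
  simp [t, x, y]

theorem eval_h_s14 (v : Fin 2 → ℝ) :
    MvPolynomial.eval v h =
      MvPolynomial.eval v t * (v 0 * MvPolynomial.eval v t + 1) := by
  simp [h, x]

theorem eval_f (v : Fin 2 → ℝ) :
    MvPolynomial.eval v f =
      (v 0 * MvPolynomial.eval v t + 1) ^ 2 * (MvPolynomial.eval v t ^ 2 + v 1) := by
  simp [f, x, y]

/-- The rational parametrization of the level set `P = 0`: at the point
`(x₀, y₀)` determined by the parameter `r`, we have `P = 0`, `h = r`, and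
`Q = (197/4)r⁴ + 104r³ + 63r² > 0`. -/
theorem pinchuk_level_zero (r : ℝ) (hr0 : r ≠ 0) (hr2 : r ≠ -2) :
    MvPolynomial.eval
        ![(-r) * (r + 1) / (-2 * r - r ^ 2) ^ 2,
          (-2 * r - r ^ 2) ^ 2 * (-r - r ^ 2) / r ^ 2] P = 0 ∧
    MvPolynomial.eval
        ![(-r) * (r + 1) / (-2 * r - r ^ 2) ^ 2,
          (-2 * r - r ^ 2) ^ 2 * (-r - r ^ 2) / r ^ 2] h = r ∧
    MvPolynomial.eval
        ![(-r) * (r + 1) / (-2 * r - r ^ 2) ^ 2,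
          (-2 * r - r ^ 2) ^ 2 * (-r - r ^ 2) / r ^ 2] Q =
      (197 / 4) * r ^ 4 + 104 * r ^ 3 + 63 * r ^ 2 ∧
    0 < (197 / 4) * r ^ 4 + 104 * r ^ 3 + 63 * r ^ 2 := by
  have hr2' : r + 2 ≠ 0 := fun e => hr2 (by linarith)
  have hd : -2 * r - r ^ 2 ≠ 0 := by
    rw [show -2 * r - r ^ 2 = -(r * (r + 2)) by ring]
    exact neg_ne_zero.mpr (mul_ne_zero hr0 hr2')
  set v : Fin 2 → ℝ := ![(-r) * (r + 1) / (-2 * r - r ^ 2) ^ 2,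
    (-2 * r - r ^ 2) ^ 2 * (-r - r ^ 2) / r ^ 2] with hv
  have hv0 : v 0 = -(r + 1) / (r * (r + 2) ^ 2) := by
    simp only [hv, Matrix.cons_val_zero]
    rw [div_eq_div_iff (pow_ne_zero 2 hd) (mul_ne_zero hr0 (pow_ne_zero 2 hr2'))]
    ring
  have hv1 : v 1 = -(r * (r + 1) * (r + 2) ^ 2) := by
    simp only [hv, Matrix.cons_val_one, Matrix.cons_val_fin_one]
    rw [div_eq_iff (pow_ne_zero 2 hr0)]
    ring
  have ht : MvPolynomial.eval v t = r * (r + 2) := by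
    rw [eval_t, hv0, hv1]
    field_simp
    ring
  have hxt : v 0 * (r * (r + 2)) + 1 = 1 / (r + 2) := by
    rw [hv0]
    field_simp
    ring
  have hh : MvPolynomial.eval v h = r := by
    rw [eval_h_s14, ht, hxt]
    field_simp
  have hf : MvPolynomial.eval v f = -r := by
    rw [eval_f, ht, hxt, hv1]
    field_simp
    ring
  refine ⟨?_, hh, ?_, ?_⟩
  · simp [P, hf, hh]
  · simp only [Q, q, u, map_sub, map_add, map_mul, map_pow, map_neg, map_one, map_ofNat,
      MvPolynomial.eval_C, hf, hh, ht]
    ring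
  · have hpos : 0 < r ^ 2 := by positivity
    have hquad : 0 < (197 / 4) * r ^ 2 + 104 * r + 63 := by
      nlinarith [sq_nonneg (197 * r + 208)]
    nlinarith [mul_pos hpos hquad]
end
end

section
/- Let q₀ : ℝ → ℝ be given by q₀(r) = (197/4)r⁴ + 104r³ + 63r². Then for every real d > 0 there exists exactly one r < 0 with q₀(r) = d and exactly one r > 0 with q₀(r) = d. -/
noncomputable section

/-- The restriction of `Q` to the level curves `P = 0`, as a function of the parameter. -/
def q₀ (r : ℝ) : ℝ := (197 / 4) * r ^ 4 + 104 * r ^ 3 + 63 * r ^ 2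

theorem q₀_zero : q₀ 0 = 0 := by simp [q₀]

theorem hasDerivAt_q₀ (r : ℝ) : HasDerivAt q₀ (r * (197 * r ^ 2 + 312 * r + 126)) r := by
  have h := (((hasDerivAt_pow 4 r).const_mul (197 / 4)).add
    ((hasDerivAt_pow 3 r).const_mul 104)).add ((hasDerivAt_pow 2 r).const_mul 63)
  refine h.congr_deriv ?_
  norm_num
  ring

theorem continuous_q₀ : Continuous q₀ := by
  unfold q₀
  fun_prop

theorem deriv_q₀_factor_pos (r : ℝ) : 0 < 197 * r ^ 2 + 312 * r + 126 := by
  nlinarith [sq_nonneg (197 * r + 156)]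

theorem strictMonoOn_q₀ : StrictMonoOn q₀ (Set.Ici 0) := by
  refine strictMonoOn_of_deriv_pos (convex_Ici 0) continuous_q₀.continuousOn fun r hr => ?_
  rw [interior_Ici] at hr
  rw [(hasDerivAt_q₀ r).deriv]
  exact mul_pos hr (deriv_q₀_factor_pos r)

theorem strictAntiOn_q₀ : StrictAntiOn q₀ (Set.Iic 0) := by
  refine strictAntiOn_of_deriv_neg (convex_Iic 0) continuous_q₀.continuousOn fun r hr => ?_
  rw [interior_Iic] at hr
  rw [(hasDerivAt_q₀ r).deriv]
  exact mul_neg_of_neg_of_pos hr (deriv_q₀_factor_pos r)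

theorem sq_le_q₀ (r : ℝ) : r ^ 2 ≤ q₀ r := by
  have h : 0 ≤ 197 / 4 * r ^ 2 + 104 * r + 62 := by nlinarith [sq_nonneg (197 * r + 208)]
  have := mul_nonneg (sq_nonneg r) h
  unfold q₀
  linarith

/-- Every positive real `d` is attained by `q₀` exactly once on the negative reals and
exactly once on the positive reals. -/
theorem q0_two_preimages (d : ℝ) (hd : 0 < d) :
    (∃! r : ℝ, r < 0 ∧ q₀ r = d) ∧ (∃! r : ℝ, 0 < r ∧ q₀ r = d) := by
  have hne {r : ℝ} (hr : q₀ r = d) : r ≠ 0 := by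
    rintro rfl
    exact hd.ne (q₀_zero.symm.trans hr)
  constructor
  · obtain ⟨r, hr, hrd⟩ := intermediate_value_Icc' (by linarith : -(1 + d) ≤ 0)
      continuous_q₀.continuousOn
      (show d ∈ Set.Icc (q₀ 0) (q₀ (-(1 + d))) from
        ⟨q₀_zero.trans_le hd.le, by nlinarith [sq_le_q₀ (-(1 + d))]⟩)
    exact ⟨r, ⟨hr.2.lt_of_ne (hne hrd), hrd⟩, fun s hs =>
      strictAntiOn_q₀.injOn hs.1.le hr.2 (hs.2.trans hrd.symm)⟩
  · obtain ⟨r, hr, hrd⟩ := intermediate_value_Icc (by linarith : 0 ≤ 1 + d)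
      continuous_q₀.continuousOn
      (show d ∈ Set.Icc (q₀ 0) (q₀ (1 + d)) from
        ⟨q₀_zero.trans_le hd.le, by nlinarith [sq_le_q₀ (1 + d)]⟩)
    exact ⟨r, ⟨hr.1.lt_of_ne (hne hrd).symm, hrd⟩, fun s hs =>
      strictMonoOn_q₀.injOn hs.1.le hr.1 (hs.2.trans hrd.symm)⟩
end
end

section
/- Let k be a subfield of ℝ. Suppose Q₁, Q₂ ∈ MvPolynomial (Fin 2) ℝ have all their coefficients in k, and S ∈ Polynomial ℝ satisfies Q₂ = Q₁ + Polynomial.aeval P S, where P is the Pinchuk polynomial. Then S is unique (if S' ∈ Polynomial ℝ also satisfies Q₂ = Q₁ + Polynomial.aeval P S', then S' = S), and every coefficient of S lies in k. -/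
noncomputable section

/-- Restriction of a bivariate polynomial to the line `x = 0`, with coordinate `y`. -/
def restrictYAxis (R : Type*) [CommSemiring R] : MvPolynomial (Fin 2) R →ₐ[R] Polynomial R :=
  MvPolynomial.aeval ![0, Polynomial.X]

/-- The Pinchuk polynomial restricts to the coordinate `y` on the line `x = 0`. -/
theorem restrictYAxis_P : restrictYAxis ℝ P = Polynomial.X := by
  simp [restrictYAxis, P, f, h, t, x, y]

theorem restrictYAxis_aeval_P (S : Polynomial ℝ) :
    restrictYAxis ℝ (Polynomial.aeval P S) = S := by
  rw [← Polynomial.aeval_algHom_apply, restrictYAxis_P, Polynomial.aeval_X_left_apply]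

theorem restrictYAxis_map {R R' : Type*} [CommSemiring R] [CommSemiring R'] (g : R →+* R')
    (q : MvPolynomial (Fin 2) R) :
    restrictYAxis R' (MvPolynomial.map g q) = (restrictYAxis R q).map g := by
  induction q using MvPolynomial.induction_on with
  | C a => simp [restrictYAxis, Polynomial.algebraMap_eq]
  | add p q hp hq => simp [hp, hq]
  | mul_X p i hp =>
    simp only [map_mul, hp, Polynomial.map_mul, MvPolynomial.map_X]
    fin_cases i <;> simp [restrictYAxis]

theorem coeff_restrictYAxis_mem (k : Subfield ℝ) {Q : R2}
    (hQ : ∀ m, MvPolynomial.coeff m Q ∈ k) (n : ℕ) : (restrictYAxis ℝ Q).coeff n ∈ k := by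
  obtain ⟨q, rfl⟩ : ∃ q, MvPolynomial.map k.subtype q = Q := by
    refine MvPolynomial.mem_range_map_iff_coeffs_subset.mpr fun a ha => ?_
    obtain ⟨m, -, rfl⟩ := MvPolynomial.mem_coeffs_iff.mp ha
    exact ⟨⟨_, hQ m⟩, rfl⟩
  rw [restrictYAxis_map, Polynomial.coeff_map]
  exact ((restrictYAxis k q).coeff n).2

/-- If two Pinchuk second components `Q₁`, `Q₂` defined over a subfield `k` of `ℝ` are
connected by `Q₂ = Q₁ + S(P)`, then `S` is unique and all its coefficients lie in `k`. -/
theorem pinchuk_connecting_polynomial (k : Subfield ℝ) (Q₁ Q₂ : R2)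
    (hQ₁ : ∀ m, MvPolynomial.coeff m Q₁ ∈ k) (hQ₂ : ∀ m, MvPolynomial.coeff m Q₂ ∈ k)
    (S : Polynomial ℝ) (hS : Q₂ = Q₁ + Polynomial.aeval P S) :
    (∀ S' : Polynomial ℝ, Q₂ = Q₁ + Polynomial.aeval P S' → S' = S) ∧
    (∀ n, S.coeff n ∈ k) := by
  have restrict_eq : ∀ T : Polynomial ℝ, Q₂ = Q₁ + Polynomial.aeval P T →
      T = restrictYAxis ℝ Q₂ - restrictYAxis ℝ Q₁ := by
    rintro T rfl
    rw [map_add, restrictYAxis_aeval_P, add_sub_cancel_left]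
  refine ⟨fun S' hS' => (restrict_eq S' hS').trans (restrict_eq S hS).symm, fun n => ?_⟩
  rw [restrict_eq S hS, Polynomial.coeff_sub]
  exact k.sub_mem (coeff_restrictYAxis_mem k hQ₂ n) (coeff_restrictYAxis_mem k hQ₁ n)
end
end
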